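/- arXiv:2603.07722 — 3 statements merged into one kernel-verified Lean document; each statement's English description precedes it below -/
import Mathlib

section
/- Sharp support-function characterization (Theorem 1). Suppose Assumptions 1 and 2 hold. Then for every F ∈ 𝓕 and every θ ∈ Θ, θ ∈ Θ_I(F) if and only if ∫ γ(λ,z;θ) dF ≥ 0 for all λ ∈ 𝒮; equivalently, Θ_I(F) = Θ̃(F). -/
open MeasureTheory Set
open scoped ENNReal RealInnerProductSpace

noncomputable section

/-- The positive part of an extended real, as an extended nonnegative real. -/
def EReal.posPart (x : EReal) : ℝ≥0∞ := if x = ⊤ then ⊤ else ENNReal.ofReal x.toReal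

/-- The integral of an `EReal`-valued function: the integral of its positive part
minus the integral of its negative part (an element of `EReal`). -/
def integralEReal {𝓩 : Type*} [MeasurableSpace 𝓩] (F : Measure 𝓩) (f : 𝓩 → EReal) : EReal :=
  ((∫⁻ z, (f z).posPart ∂F : ℝ≥0∞) : EReal) - ((∫⁻ z, (-(f z)).posPart ∂F : ℝ≥0∞) : EReal)

variable {𝓤 𝓩 : Type*}
  [MeasurableSpace 𝓤] [TopologicalSpace 𝓤] [PolishSpace 𝓤] [BorelSpace 𝓤]
  [MeasurableSpace 𝓩] [TopologicalSpace 𝓩] [PolishSpace 𝓩] [BorelSpace 𝓩]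
  {Θ : Type*}

/-- The section `Γ(z;θ) = {u : (u,z) ∈ Γ(θ)}`. -/
def sectionSet (Γθ : Set (𝓤 × 𝓩)) (z : 𝓩) : Set 𝓤 := {u | (u, z) ∈ Γθ}

/-- The set `𝓡(z;θ)` of moment values consistent with the support restriction at `z`. -/
def momentSet {d : ℕ} (Γθ : Set (𝓤 × 𝓩)) (rθ : 𝓤 → 𝓩 → EuclideanSpace ℝ (Fin d)) (z : 𝓩) :
    Set (EuclideanSpace ℝ (Fin d)) := (fun u => rθ u z) '' sectionSet Γθ z

/-- The support function `γ(λ,z;θ) = sup {λᵀt : t ∈ 𝓡(z;θ)}`, with values in `EReal`. -/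
def suppFun {d : ℕ} (Γθ : Set (𝓤 × 𝓩)) (rθ : 𝓤 → 𝓩 → EuclideanSpace ℝ (Fin d))
    (l : EuclideanSpace ℝ (Fin d)) (z : 𝓩) : EReal :=
  sSup ((fun t => ((⟪l, t⟫ : ℝ) : EReal)) '' momentSet Γθ rθ z)

/-- Assumption 1 at a single parameter value and a single distribution. -/
structure Assumption1At {d : ℕ} (F : Measure 𝓩) (Γθ : Set (𝓤 × 𝓩))
    (rθ : 𝓤 → 𝓩 → EuclideanSpace ℝ (Fin d)) : Prop where
  borel_Gamma : MeasurableSet Γθ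
  nonempty_section : ∀ z, (sectionSet Γθ z).Nonempty
  borel_section : ∀ z, MeasurableSet (sectionSet Γθ z)
  measurable_r : Measurable fun p : 𝓤 × 𝓩 => rθ p.1 p.2
  lower_envelope : ∃ g : 𝓩 → ℝ, Measurable g ∧ Integrable g F ∧
    ∀ᵐ z ∂F, sInf (norm '' momentSet Γθ rθ z) ≤ g z

/-- Assumption 1: measurability, nonempty sections, and an integrable lower envelope for
the infimum of the norm over the moment set. -/
def Assumption1 {d : ℕ} (𝓕 : Set (Measure 𝓩)) (Γ : Θ → Set (𝓤 × 𝓩))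
    (r : Θ → 𝓤 → 𝓩 → EuclideanSpace ℝ (Fin d)) : Prop :=
  ∀ θ : Θ, ∀ F ∈ 𝓕, Assumption1At F (Γ θ) (r θ)

/-- Assumption 2 at a single parameter value and distribution: closedness and
integrable boundedness of the moment sets. -/
structure Assumption2At {d : ℕ} (F : Measure 𝓩) (Γθ : Set (𝓤 × 𝓩))
    (rθ : 𝓤 → 𝓩 → EuclideanSpace ℝ (Fin d)) : Prop where
  closed_momentSet : ∀ᵐ z ∂F, IsClosed (momentSet Γθ rθ z)
  upper_envelope : ∃ g : 𝓩 → ℝ, Measurable g ∧ Integrable g F ∧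
    ∀ᵐ z ∂F, ∀ t ∈ momentSet Γθ rθ z, ‖t‖ ≤ g z

/-- Assumption 2 (closedness and integrable boundedness). -/
def Assumption2 {d : ℕ} (𝓕 : Set (Measure 𝓩)) (Γ : Θ → Set (𝓤 × 𝓩))
    (r : Θ → 𝓤 → 𝓩 → EuclideanSpace ℝ (Fin d)) : Prop :=
  ∀ θ : Θ, ∀ F ∈ 𝓕, Assumption2At F (Γ θ) (r θ)

/-- `θ` belongs to the identified set `Θ_I(F)`: there is a Borel probability measure `H`
on `𝓤 × 𝓩` giving probability one to the support restriction, with `𝓩`-marginal `F`,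
under which the moment function is integrable with mean zero. -/
def MemIdentified {d : ℕ} (Γθ : Set (𝓤 × 𝓩)) (rθ : 𝓤 → 𝓩 → EuclideanSpace ℝ (Fin d))
    (F : Measure 𝓩) : Prop :=
  ∃ H : Measure (𝓤 × 𝓩), IsProbabilityMeasure H ∧ H Γθ = 1 ∧ H.map Prod.snd = F ∧
    Integrable (fun p : 𝓤 × 𝓩 => rθ p.1 p.2) H ∧ (∫ p : 𝓤 × 𝓩, rθ p.1 p.2 ∂H) = 0

/-- `θ` belongs to the moment closure `Θ̄_I(F)` of the identified set. -/
def MemMomentClosure {d : ℕ} (Γθ : Set (𝓤 × 𝓩)) (rθ : 𝓤 → 𝓩 → EuclideanSpace ℝ (Fin d))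
    (F : Measure 𝓩) : Prop :=
  ∀ ε : ℝ, 0 < ε → ∃ H : Measure (𝓤 × 𝓩), IsProbabilityMeasure H ∧ H Γθ = 1 ∧
    H.map Prod.snd = F ∧ Integrable (fun p : 𝓤 × 𝓩 => rθ p.1 p.2) H ∧
    ‖∫ p : 𝓤 × 𝓩, rθ p.1 p.2 ∂H‖ ≤ ε

/-- `θ` belongs to the support-function set `Θ̃(F)`:
`∫ γ(λ,z;θ) dF ≥ 0` for every `λ` in the unit sphere. -/
def MemSFSet {d : ℕ} (Γθ : Set (𝓤 × 𝓩)) (rθ : 𝓤 → 𝓩 → EuclideanSpace ℝ (Fin d))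
    (F : Measure 𝓩) : Prop :=
  ∀ l : EuclideanSpace ℝ (Fin d), ‖l‖ = 1 → (0 : EReal) ≤ integralEReal F (suppFun Γθ rθ l)

/-- The image of the Baire space under a continuous map can be approximated in measure from inside
by compact sets. -/
lemma exists_isCompact_subset_range_le_measure {Z : Type*} [TopologicalSpace Z] [T2Space Z]
    [MeasurableSpace Z] (μ : Measure Z) [μ.OuterRegular] {f : (ℕ → ℕ) → Z} (hf : Continuous f)
    {c : ℝ≥0∞} (hc : c < μ (range f)) : ∃ K ⊆ range f, IsCompact K ∧ c ≤ μ K := by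
  have step : ∀ (T : {T : Set (ℕ → ℕ) // c < μ (f '' T)}) (k : ℕ),
      ∃ m : ℕ, c < μ (f '' (T.1 ∩ {x | x k ≤ m})) := by
    intro T k
    have hU : f '' T.1 = ⋃ m : ℕ, f '' (T.1 ∩ {x | x k ≤ m}) := by
      rw [← image_iUnion, ← inter_iUnion]
      congr 1
      refine (inter_eq_left.2 fun x _ => mem_iUnion.2 ⟨x k, ?_⟩).symm
      simp
    have hT := T.2
    rw [hU, Monotone.measure_iUnion] at hT
    · exact lt_iSup_iff.1 hT
    · intro a b hab
      exact image_mono (inter_subset_inter_right _ fun x hx => le_trans hx hab)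
  choose m hm using step
  let T : ℕ → {T : Set (ℕ → ℕ) // c < μ (f '' T)} := fun k =>
    Nat.rec ⟨univ, by simpa using hc⟩ (fun k T => ⟨T.1 ∩ {x | x k ≤ m T k}, hm T k⟩) k
  let b : ℕ → ℕ := fun k => m (T k) k
  have hT : ∀ k, (T k).1 = {x | ∀ i < k, x i ≤ b i} := by
    intro k
    induction k with
    | zero => simp [T]
    | succ k ih =>
      have : (T (k + 1)).1 = (T k).1 ∩ {x | x k ≤ b k} := rfl
      rw [this, ih]
      ext x
      simp only [mem_inter_iff, mem_ofPred_eq]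
      constructor
      · rintro ⟨h1, h2⟩ i hi
        rcases Nat.lt_succ_iff_lt_or_eq.1 hi with h | rfl
        · exact h1 i h
        · exact h2
      · exact fun h => ⟨fun i hi => h i (by omega), h k (by omega)⟩
  have hcomp : IsCompact (univ.pi fun i => Iic (b i)) :=
    isCompact_univ_pi fun i => (finite_Iic (b i)).isCompact
  refine ⟨f '' univ.pi fun i => Iic (b i), image_subset_range _ _, hcomp.image hf, ?_⟩
  by_contra! hlt
  obtain ⟨V, hKV, hVo, hVc⟩ := Set.exists_isOpen_lt_of_lt _ _ hlt
  have hx : ∀ k, ∃ x, (∀ i < k, x i ≤ b i) ∧ f x ∉ V := by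
    intro k
    by_contra! h
    refine absurd ((T k).2.trans_le ?_) hVc.not_gt
    refine measure_mono ?_
    rw [hT k]
    rintro _ ⟨x, hx, rfl⟩
    exact h x hx
  choose x hxb hxV using hx
  obtain ⟨y, hy, φ, hφ, hlim⟩ := hcomp.tendsto_subseq (x := fun k i => min (x k i) (b i))
    fun k i _ => mem_Iic.2 (min_le_right (x k i) (b i))
  have hlim' : Filter.Tendsto (x ∘ φ) Filter.atTop (nhds y) := by
    rw [tendsto_pi_nhds] at hlim ⊢
    intro i
    refine (hlim i).congr' ?_
    filter_upwards [Filter.eventually_gt_atTop i] with k hk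
    exact min_eq_left (hxb _ i (hk.trans_le hφ.le_apply))
  have hmem : ∀ᶠ k in Filter.atTop, f (x (φ k)) ∈ V :=
    ((hf.tendsto y).comp hlim') (hVo.mem_nhds (hKV (mem_image_of_mem f hy)))
  obtain ⟨k, hk⟩ := hmem.exists
  exact hxV _ hk

/-- Analytic sets are measurable with respect to the completion of every finite Borel measure. -/
lemma MeasureTheory.AnalyticSet.nullMeasurableSet {Z : Type*} [TopologicalSpace Z] [T2Space Z]
    [MeasurableSpace Z] [BorelSpace Z] (μ : Measure Z) [IsFiniteMeasure μ] [μ.OuterRegular]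
    {s : Set Z} (hs : AnalyticSet s) : NullMeasurableSet s μ := by
  rw [AnalyticSet] at hs
  obtain rfl | ⟨f, hf, rfl⟩ := hs
  · exact nullMeasurableSet_empty
  rcases eq_or_ne (μ (range f)) 0 with h0 | h0
  · exact NullMeasurableSet.of_null h0
  obtain ⟨c, -, hc, hlim⟩ := exists_seq_strictMono_tendsto' (pos_iff_ne_zero.2 h0)
  choose K hKs hK hcK using fun n =>
    exists_isCompact_subset_range_le_measure μ hf (hc n).2
  have hm : MeasurableSet (⋃ n, K n) := MeasurableSet.iUnion fun n => (hK n).measurableSet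
  refine hm.nullMeasurableSet.congr (ae_eq_of_subset_of_measure_ge (iUnion_subset hKs) ?_
    hm.nullMeasurableSet (measure_ne_top _ _))
  exact le_of_tendsto' hlim fun n => (hcK n).trans (measure_mono (subset_iUnion K n))

/-- A continuous map from the Baire space has a right inverse on its range that is measurable for
any `σ`-algebra containing the images of the cylinder sets. -/
lemma exists_measurable_rightInverse {Z : Type*} [TopologicalSpace Z] [T2Space Z]
    {mZ : MeasurableSpace Z} {g : (ℕ → ℕ) → Z} (hg : Continuous g)
    (hcyl : ∀ l : List ℕ, MeasurableSet (g '' {x | PiNat.res x l.length = l})) :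
    ∃ s : Z → ℕ → ℕ, Measurable s ∧ ∀ z ∈ range g, g (s z) = z := by
  classical
  let A : List ℕ → Set Z := fun l => g '' {x | PiNat.res x l.length = l}
  let m : List ℕ → Z → ℕ := fun l z => sInf {n | z ∈ A (n :: l)}
  let p : ℕ → Z → List ℕ := fun k z => Nat.rec [] (fun _ l => m l z :: l) k
  have hp : ∀ k z, p (k + 1) z = m (p k z) z :: p k z := fun _ _ => rfl
  have hm : ∀ l n, MeasurableSet {z | m l z = n} := by
    intro l n
    have : {z | m l z = n} = A (n :: l) ∩ (⋂ k, ⋂ (_ : k < n), (A (k :: l))ᶜ) ∪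
        {z | n = 0} ∩ ⋂ k, (A (k :: l))ᶜ := by
      ext z
      simp only [mem_ofPred_eq, mem_union, mem_inter_iff, mem_iInter, mem_compl_iff, m]
      constructor
      · rintro rfl
        rcases eq_empty_or_nonempty {n | z ∈ A (n :: l)} with h | h
        · right
          exact ⟨by simp [h], eq_empty_iff_forall_notMem.1 h⟩
        · exact Or.inl ⟨Nat.sInf_mem h, fun k hk => Nat.notMem_of_lt_sInf hk⟩
      · rintro (⟨h1, h2⟩ | ⟨rfl, h⟩)
        · refine le_antisymm (Nat.sInf_le h1) ?_
          by_contra! hlt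
          exact h2 _ hlt (Nat.sInf_mem (s := {n | z ∈ A (n :: l)}) ⟨n, h1⟩)
        · exact Nat.sInf_eq_zero.2 (Or.inr (eq_empty_iff_forall_notMem.2 h))
    rw [this]
    exact ((hcyl _).inter (MeasurableSet.iInter fun k => MeasurableSet.iInter fun _ =>
      (hcyl _).compl)).union
      ((MeasurableSet.const _).inter (MeasurableSet.iInter fun k => (hcyl _).compl))
  have hpm : ∀ k l, MeasurableSet {z | p k z = l} := by
    intro k
    induction k with
    | zero => exact fun l => MeasurableSet.const ([] = l)
    | succ k ih =>
      rintro (_ | ⟨n, l⟩)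
      · simp [hp]
      · have : {z | p (k + 1) z = n :: l} = {z | p k z = l} ∩ {z | m l z = n} := by
          ext z
          simp only [hp, List.cons.injEq, mem_ofPred_eq, mem_inter_iff]
          constructor
          · rintro ⟨h1, rfl⟩
            exact ⟨rfl, h1⟩
          · rintro ⟨rfl, h1⟩
            exact ⟨h1, rfl⟩
        rw [this]
        exact (ih l).inter (hm l n)
  let s : Z → ℕ → ℕ := fun z k => m (p k z) z
  have hres : ∀ z k, PiNat.res (s z) k = p k z := by
    intro z k
    induction k with
    | zero => rfl
    | succ k ih => rw [PiNat.res_succ, hp, ih]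
  refine ⟨s, ?_, ?_⟩
  · refine measurable_pi_lambda _ fun k => measurable_to_countable' fun n => ?_
    have : (fun z => s z k) ⁻¹' {n} = ⋃ l, {z | p k z = l} ∩ {z | m l z = n} := by
      ext z
      simp [s]
    rw [this]
    exact MeasurableSet.iUnion fun l => (hpm k l).inter (hm l n)
  · rintro z ⟨x₀, hx₀⟩
    have hx : ∀ k, ∃ x, PiNat.res x k = p k z ∧ g x = z := by
      intro k
      induction k with
      | zero => exact ⟨x₀, rfl, hx₀⟩
      | succ k ih =>
        obtain ⟨x, hx, hxz⟩ := ih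
        have hlen : (p k z).length = k := by rw [← hx, PiNat.res_length]
        have hne : {n | z ∈ A (n :: p k z)}.Nonempty :=
          ⟨x k, x, by simp [hlen, PiNat.res_succ, hx], hxz⟩
        obtain ⟨y, hy, hyz⟩ := Nat.sInf_mem hne
        refine ⟨y, ?_, hyz⟩
        rw [hp]
        simpa only [List.length_cons, hlen, mem_ofPred_eq] using hy
    choose x hxp hxz using hx
    have hlim : Filter.Tendsto x Filter.atTop (nhds (s z)) := by
      refine tendsto_pi_nhds.2 fun i => tendsto_const_nhds.congr' ?_
      filter_upwards [Filter.eventually_gt_atTop i] with k hk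
      exact (PiNat.res_eq_res.1 ((hxp k).trans (hres z k).symm) hk).symm
    refine tendsto_nhds_unique ((hg.tendsto _).comp hlim) ?_
    exact tendsto_const_nhds.congr fun k => (hxz k).symm

lemma isClosed_setOf_res_eq (l : List ℕ) :
    IsClosed {x : ℕ → ℕ | PiNat.res x l.length = l} := by
  induction l with
  | nil => simp
  | cons n l ih =>
    simp only [List.length_cons, PiNat.res_succ, List.cons.injEq]
    exact (isClosed_eq (continuous_apply _) continuous_const).inter ih

/-- **Measurable selection** (almost everywhere form of the Jankov–von Neumann theorem). -/
lemma exists_measurable_selection {U Z : Type*}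
    [MeasurableSpace U] [TopologicalSpace U] [PolishSpace U] [BorelSpace U]
    [MeasurableSpace Z] [TopologicalSpace Z] [PolishSpace Z] [BorelSpace Z]
    (μ : Measure Z) [IsFiniteMeasure μ] [NeZero μ] {G : Set (U × Z)} (hG : MeasurableSet G)
    (hne : ∀ᵐ z ∂μ, ∃ u, (u, z) ∈ G) :
    ∃ φ : Z → U, Measurable φ ∧ ∀ᵐ z ∂μ, (φ z, z) ∈ G := by
  have hGa := hG.analyticSet
  rw [AnalyticSet] at hGa
  obtain rfl | ⟨f, hf, rfl⟩ := hGa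
  · simp only [mem_empty_iff_false, exists_false, Filter.eventually_false_iff_eq_bot,
      ae_eq_bot] at hne
    exact absurd hne (NeZero.ne μ)
  let g : (ℕ → ℕ) → Z := fun x => (f x).2
  have hg : Continuous g := continuous_snd.comp hf
  obtain ⟨s, hs, hsg⟩ : ∃ s : Z → ℕ → ℕ, NullMeasurable s μ ∧ ∀ z ∈ range g, g (s z) = z :=
    exists_measurable_rightInverse (Z := Z) (mZ := NullMeasurableSpace.instMeasurableSpace (μ := μ)) hg
      fun l => ((isClosed_setOf_res_eq l).analyticSet.image_of_continuous hg).nullMeasurableSet μ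
  have hs' : AEMeasurable s μ := hs.aemeasurable
  refine ⟨fun z => (f (hs'.mk s z)).1,
    (continuous_fst.comp hf).measurable.comp hs'.measurable_mk, ?_⟩
  filter_upwards [hne, hs'.ae_eq_mk] with z ⟨u, x, hx⟩ hz
  refine ⟨s z, ?_⟩
  have h1 : (f (s z)).2 = z := hsg z ⟨x, by simp [g, hx]⟩
  exact Prod.ext (by rw [← hz]) h1

/-- A nonempty convex set in a finite-dimensional inner product space that does not contain the
origin lies in a closed half-space through the origin. -/
lemma Convex.exists_norm_eq_one_forall_inner_nonpos {E : Type*} [NormedAddCommGroup E]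
    [InnerProductSpace ℝ E] [FiniteDimensional ℝ E] {M : Set E} (hM : Convex ℝ M)
    (hne : M.Nonempty) (h0 : (0 : E) ∉ M) : ∃ l : E, ‖l‖ = 1 ∧ ∀ m ∈ M, ⟪l, m⟫ ≤ 0 := by
  by_contra! hcon
  have hcover : Metric.sphere (0 : E) 1 ⊆ ⋃ m : M, {l | 0 < ⟪l, (m : E)⟫} := by
    intro l hl
    obtain ⟨m, hm, hlm⟩ := hcon l (by simpa using hl)
    exact mem_iUnion.2 ⟨⟨m, hm⟩, hlm⟩
  obtain ⟨t, ht⟩ := (isCompact_sphere (0 : E) 1).elim_finite_subcover _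
    (fun m : M => isOpen_lt continuous_const (continuous_id.inner continuous_const)) hcover
  have hfin : ((fun m : M => (m : E)) '' (t : Set M)).Finite := t.finite_toSet.image _
  have hsub : convexHull ℝ ((fun m : M => (m : E)) '' (t : Set M)) ⊆ M :=
    convexHull_min (by rintro _ ⟨m, -, rfl⟩; exact m.2) hM
  obtain ⟨f, u, hfu, hu⟩ := geometric_hahn_banach_closed_point (convex_convexHull ℝ _)
    (hfin.isClosed_convexHull ℝ) (fun h => h0 (hsub h))
  rw [map_zero] at hu
  set w := (InnerProductSpace.toDual ℝ E).symm f with hw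
  have hwf : ∀ x, ⟪w, x⟫ = f x := fun x => InnerProductSpace.toDual_symm_apply
  have hneg : ∀ m ∈ t, ⟪w, (m : E)⟫ < 0 := fun m hm => by
    rw [hwf]
    exact (hfu _ (subset_convexHull ℝ _ ⟨m, hm, rfl⟩)).trans hu
  obtain ⟨m₀, hm₀⟩ := hne
  have hm₀' : m₀ ≠ 0 := fun h => h0 (h ▸ hm₀)
  have key : ∀ l : E, l ≠ 0 → ∃ m ∈ t, 0 < ⟪l, (m : E)⟫ := by
    intro l hl
    obtain ⟨m, hm, hlm⟩ := mem_iUnion₂.1 (ht (show ‖l‖⁻¹ • l ∈ Metric.sphere (0 : E) 1 by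
      simp [norm_smul, hl]))
    refine ⟨m, hm, ?_⟩
    have : 0 < ‖l‖⁻¹ * ⟪l, (m : E)⟫ := by simpa [real_inner_smul_left] using hlm
    exact pos_of_mul_pos_right this (by positivity)
  obtain ⟨m₁, hm₁, -⟩ := key m₀ hm₀'
  have hw0 : w ≠ 0 := fun h => by simpa [h] using hneg m₁ hm₁
  obtain ⟨m, hm, hlm⟩ := key w hw0
  exact hlm.not_gt (hneg m hm)

/-- The real-valued support function of a set. -/
def realSupport {E : Type*} [NormedAddCommGroup E] [InnerProductSpace ℝ E] (K : Set E) (l : E) : ℝ :=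
  sSup ((fun t => ⟪l, t⟫) '' K)

section RealSupport

variable {E : Type*} [NormedAddCommGroup E] [InnerProductSpace ℝ E] {K : Set E}

lemma IsCompact.inner_le_realSupport (hK : IsCompact K) (l : E) {t : E} (ht : t ∈ K) :
    ⟪l, t⟫ ≤ realSupport K l :=
  le_csSup (hK.image (by fun_prop)).bddAbove (mem_image_of_mem _ ht)

lemma IsCompact.exists_inner_eq_realSupport (hK : IsCompact K) (hne : K.Nonempty) (l : E) :
    ∃ t ∈ K, ⟪l, t⟫ = realSupport K l :=
  (hK.image (f := fun t => ⟪l, t⟫) (by fun_prop)).sSup_mem (hne.image _)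

lemma IsCompact.abs_realSupport_add_sub_le (hK : IsCompact K) (hne : K.Nonempty) {g : ℝ}
    (hg : ∀ t ∈ K, ‖t‖ ≤ g) (l v : E) :
    |realSupport K (l + v) - realSupport K l| ≤ ‖v‖ * g := by
  obtain ⟨s, hs, hsl⟩ := hK.exists_inner_eq_realSupport hne l
  obtain ⟨t, ht, htl⟩ := hK.exists_inner_eq_realSupport hne (l + v)
  have h1 := hK.inner_le_realSupport (l + v) hs
  have h2 := hK.inner_le_realSupport l ht
  have h3 : ∀ t ∈ K, |⟪v, t⟫| ≤ ‖v‖ * g := fun t ht =>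
    (abs_real_inner_le_norm v t).trans (by gcongr; exact hg t ht)
  have h4 := abs_le.1 (h3 s hs)
  have h5 := abs_le.1 (h3 t ht)
  rw [inner_add_left] at h1 htl
  rw [abs_le]
  constructor <;> linarith

lemma realSupport_zero (hne : K.Nonempty) : realSupport K 0 = 0 := by
  simp [realSupport, hne.image_const]

lemma IsCompact.abs_realSupport_le (hK : IsCompact K) (hne : K.Nonempty) {g : ℝ}
    (hg : ∀ t ∈ K, ‖t‖ ≤ g) (l : E) : |realSupport K l| ≤ ‖l‖ * g := by
  simpa [realSupport_zero hne] using hK.abs_realSupport_add_sub_le hne hg 0 l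

lemma realSupport_smul_of_nonneg (l : E) {c : ℝ} (hc : 0 ≤ c) :
    realSupport K (c • l) = c * realSupport K l := by
  rw [realSupport, realSupport, ← smul_eq_mul, ← Real.sSup_smul_of_nonneg hc, ← image_smul,
    image_image]
  simp only [real_inner_smul_left, smul_eq_mul]

/-- The face of a set exposed by a linear functional. -/
def exposedFace (K : Set E) (l : E) : Set E := {t ∈ K | ⟪l, t⟫ = realSupport K l}

lemma IsCompact.isCompact_exposedFace (hK : IsCompact K) (l : E) : IsCompact (exposedFace K l) :=
  hK.inter_right (isClosed_eq (by fun_prop) continuous_const)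

lemma IsCompact.exposedFace_nonempty (hK : IsCompact K) (hne : K.Nonempty) (l : E) :
    (exposedFace K l).Nonempty :=
  hK.exists_inner_eq_realSupport hne l

/-- The one-sided directional derivative of the support function of a compact set is the support
function of the exposed face. -/
lemma IsCompact.tendsto_realSupport_slope (hK : IsCompact K) (hne : K.Nonempty) (l v : E) :
    Filter.Tendsto (fun n : ℕ => ((n : ℝ) + 1) *
      (realSupport K (l + ((n : ℝ) + 1)⁻¹ • v) - realSupport K l)) Filter.atTop
      (nhds (realSupport (exposedFace K l) v)) := by
  have hface := hK.isCompact_exposedFace l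
  obtain ⟨s, ⟨hsK, hsl⟩, hsv⟩ :=
    hface.exists_inner_eq_realSupport (hK.exposedFace_nonempty hne l) v
  have hpos : ∀ n : ℕ, (0 : ℝ) < n + 1 := fun n => by positivity
  have hlower : ∀ n : ℕ, realSupport (exposedFace K l) v ≤ ((n : ℝ) + 1) *
      (realSupport K (l + ((n : ℝ) + 1)⁻¹ • v) - realSupport K l) := by
    intro n
    have h := hK.inner_le_realSupport (l + ((n : ℝ) + 1)⁻¹ • v) hsK
    rw [inner_add_left, real_inner_smul_left, hsl, hsv] at h
    have := mul_le_mul_of_nonneg_left h (hpos n).le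
    rw [mul_add, mul_inv_cancel_left₀ (hpos n).ne'] at this
    linarith
  obtain ⟨g, hg⟩ := hK.isBounded.exists_norm_le
  refine tendsto_order.2 ⟨fun a ha => Filter.Eventually.of_forall fun n => ha.trans_le (hlower n),
    fun a ha => ?_⟩
  -- the part of `K` where `v` is too large stays away from the exposed face
  have hA : IsCompact (K ∩ {t | a ≤ ⟪v, t⟫}) :=
    hK.inter_right (isClosed_le continuous_const (by fun_prop))
  have hgap : ∃ δ > 0, ∀ t ∈ K, a ≤ ⟪v, t⟫ → ⟪l, t⟫ + δ ≤ realSupport K l := by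
    rcases (K ∩ {t | a ≤ ⟪v, t⟫}).eq_empty_or_nonempty with h | h
    · exact ⟨1, one_pos, fun t ht hat => absurd (h ▸ ⟨ht, hat⟩ : t ∈ (∅ : Set E)) (by simp)⟩
    · obtain ⟨t₀, ⟨ht₀, hat₀⟩, hmax⟩ := hA.exists_isMaxOn h
        (f := fun t => ⟪l, t⟫) (by fun_prop)
      refine ⟨realSupport K l - ⟪l, t₀⟫, ?_, fun t ht hat => ?_⟩
      · refine sub_pos.2 (lt_of_le_of_ne (hK.inner_le_realSupport l ht₀) fun heq => ?_)
        have := hface.inner_le_realSupport v (t := t₀) ⟨ht₀, heq⟩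
        exact absurd (hat₀.trans this) ha.not_ge
      · have : ⟪l, t⟫ ≤ ⟪l, t₀⟫ := hmax ⟨ht, hat⟩
        linarith
  obtain ⟨δ, hδ, hgap⟩ := hgap
  have hlim : Filter.Tendsto (fun n : ℕ => 2 * (‖v‖ * g) * ((n : ℝ) + 1)⁻¹) Filter.atTop
      (nhds 0) := by
    simpa using (tendsto_one_div_add_atTop_nhds_zero_nat (𝕜 := ℝ)).const_mul (2 * (‖v‖ * g))
  filter_upwards [hlim.eventually_lt_const hδ] with n hn
  obtain ⟨t, ht, htl⟩ := hK.exists_inner_eq_realSupport hne (l + ((n : ℝ) + 1)⁻¹ • v)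
  have hs := hK.inner_le_realSupport (l + ((n : ℝ) + 1)⁻¹ • v) hsK
  have htK := hK.inner_le_realSupport l ht
  rw [← htl] at hs ⊢
  simp only [inner_add_left, real_inner_smul_left] at hs ⊢
  have hb : ∀ t ∈ K, |((n : ℝ) + 1)⁻¹ * ⟪v, t⟫| ≤ ((n : ℝ) + 1)⁻¹ * (‖v‖ * g) := fun t ht => by
    rw [abs_mul, abs_of_pos (inv_pos.2 (hpos n))]
    gcongr
    exact (abs_real_inner_le_norm v t).trans (by gcongr; exact hg t ht)
  have hbs := abs_le.1 (hb s hsK)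
  have hbt := abs_le.1 (hb t ht)
  have hlt : ⟪v, t⟫ < a := by
    by_contra! hat
    have := hgap t ht hat
    linarith
  calc ((n : ℝ) + 1) * (⟪l, t⟫ + ((n : ℝ) + 1)⁻¹ * ⟪v, t⟫ - realSupport K l)
      = ((n : ℝ) + 1) * (⟪l, t⟫ - realSupport K l) + ⟪v, t⟫ := by
        have := (hpos n).ne'
        field_simp
        ring
    _ ≤ 0 + ⟪v, t⟫ := by
        gcongr
        exact mul_nonpos_of_nonneg_of_nonpos (hpos n).le (by linarith)
    _ < a := by linarith

end RealSupport

lemma suppFun_eq_coe_realSupport {d : ℕ} {U Z : Type*} {G : Set (U × Z)}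
    {r : U → Z → EuclideanSpace ℝ (Fin d)} {z : Z} (hne : (momentSet G r z).Nonempty)
    (hK : IsCompact (momentSet G r z)) (l : EuclideanSpace ℝ (Fin d)) :
    suppFun G r l z = realSupport (momentSet G r z) l := by
  refine le_antisymm (sSup_le ?_) ?_
  · rintro _ ⟨t, ht, rfl⟩
    exact EReal.coe_le_coe_iff.2 (hK.inner_le_realSupport l ht)
  · obtain ⟨t, ht, h⟩ := hK.exists_inner_eq_realSupport hne l
    exact le_sSup ⟨t, ht, congrArg Real.toEReal h⟩

section Moments

variable {d : ℕ} {U Z : Type*} [MeasurableSpace U] [MeasurableSpace Z] {F : Measure Z}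
  {G G' : Set (U × Z)} {r : U → Z → EuclideanSpace ℝ (Fin d)} {g : Z → ℝ} {H : Measure (U × Z)}

/-- A support restriction whose moment sets are almost surely nonempty, compact and bounded
by `g`. -/
structure IsCompactMomentDomain (F : Measure Z) (G : Set (U × Z))
    (r : U → Z → EuclideanSpace ℝ (Fin d)) (g : Z → ℝ) : Prop where
  measurableSet : MeasurableSet G
  nonempty : ∀ᵐ z ∂F, (momentSet G r z).Nonempty
  isCompact : ∀ᵐ z ∂F, IsCompact (momentSet G r z)
  norm_le : ∀ᵐ z ∂F, ∀ t ∈ momentSet G r z, ‖t‖ ≤ g z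

/-- A joint law that satisfies the support restriction and has the given marginal. -/
structure IsAdmissible (F : Measure Z) (G : Set (U × Z)) (H : Measure (U × Z)) : Prop where
  isProbabilityMeasure : IsProbabilityMeasure H
  ae_mem : ∀ᵐ p ∂H, p ∈ G
  map_snd : H.map Prod.snd = F

lemma IsAdmissible.ae_snd (hH : IsAdmissible F G H) {P : Z → Prop} (hP : ∀ᵐ z ∂F, P z) :
    ∀ᵐ p ∂H, P p.2 := by
  rw [← hH.map_snd] at hP
  exact ae_of_ae_map measurable_snd.aemeasurable hP

lemma IsAdmissible.mono (hH : IsAdmissible F G' H) (hG : G' ⊆ G) : IsAdmissible F G H :=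
  ⟨hH.1, hH.2.mono fun _ h => hG h, hH.3⟩

lemma IsAdmissible.ae_mem_momentSet (hH : IsAdmissible F G H) :
    ∀ᵐ p ∂H, r p.1 p.2 ∈ momentSet G r p.2 :=
  hH.ae_mem.mono fun p hp => ⟨p.1, hp, rfl⟩

lemma IsAdmissible.integrable (hH : IsAdmissible F G H) (hG : IsCompactMomentDomain F G r g)
    (hr : Measurable fun p : U × Z => r p.1 p.2) (hg : Integrable g F) :
    Integrable (fun p : U × Z => r p.1 p.2) H := by
  have hg' : Integrable (fun p : U × Z => g p.2) H := by
    rw [← hH.map_snd] at hg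
    exact hg.comp_measurable measurable_snd
  refine hg'.mono' hr.aestronglyMeasurable ?_
  filter_upwards [hH.ae_snd hG.norm_le, hH.ae_mem_momentSet (r := r)] with p h1 h2
  exact h1 _ h2

/-- Mixtures of admissible laws are admissible. -/
lemma IsAdmissible.convexCombination {H₁ H₂ : Measure (U × Z)} (h₁ : IsAdmissible F G H₁)
    (h₂ : IsAdmissible F G H₂) {a b : ℝ} (ha : 0 ≤ a) (hb : 0 ≤ b) (hab : a + b = 1) :
    IsAdmissible F G (ENNReal.ofReal a • H₁ + ENNReal.ofReal b • H₂) := by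
  have := h₁.isProbabilityMeasure
  have := h₂.isProbabilityMeasure
  have hab' : ENNReal.ofReal a + ENNReal.ofReal b = 1 := by
    rw [← ENNReal.ofReal_add ha hb, hab, ENNReal.ofReal_one]
  refine ⟨⟨by simp [hab']⟩, ?_, ?_⟩
  · rw [ae_add_measure_iff]
    exact ⟨Measure.ae_smul_measure h₁.ae_mem _, Measure.ae_smul_measure h₂.ae_mem _⟩
  · rw [Measure.map_add _ _ measurable_snd, Measure.map_smul, Measure.map_smul, h₁.map_snd,
      h₂.map_snd, ← add_smul, hab', one_smul]

lemma IsAdmissible.integral_snd (hH : IsAdmissible F G H) {f : Z → ℝ}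
    (hf : AEStronglyMeasurable f F) : ∫ p, f p.2 ∂H = ∫ z, f z ∂F := by
  rw [← hH.map_snd] at hf ⊢
  exact (integral_map measurable_snd.aemeasurable hf).symm

lemma EReal.posPart_coe (x : ℝ) : (x : EReal).posPart = ENNReal.ofReal x := by
  simp [EReal.posPart]

lemma integralEReal_coe {f : Z → EReal} {h : Z → ℝ} (hh : Integrable h F)
    (hf : ∀ᵐ z ∂F, f z = h z) : integralEReal F f = ((∫ z, h z ∂F : ℝ) : EReal) := by
  have h1 : ∫⁻ z, (f z).posPart ∂F = ∫⁻ z, ENNReal.ofReal (h z) ∂F :=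
    lintegral_congr_ae (hf.mono fun z hz => by simp only [hz, EReal.posPart_coe])
  have h2 : ∫⁻ z, (-(f z)).posPart ∂F = ∫⁻ z, ENNReal.ofReal (-h z) ∂F :=
    lintegral_congr_ae (hf.mono fun z hz => by
      simp only [hz, ← EReal.coe_neg, EReal.posPart_coe])
  rw [integralEReal, h1, h2, integral_eq_lintegral_pos_part_sub_lintegral_neg_part hh,
    EReal.coe_sub, EReal.coe_ennreal_toReal hh.lintegral_lt_top.ne,
    EReal.coe_ennreal_toReal (Integrable.lintegral_lt_top (f := fun z => -h z) hh.neg).ne]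

lemma Assumption1At.isCompactMomentDomain (h1 : Assumption1At F G r)
    (h2 : Assumption2At F G r) (hg : ∀ᵐ z ∂F, ∀ t ∈ momentSet G r z, ‖t‖ ≤ g z) :
    IsCompactMomentDomain F G r g where
  measurableSet := h1.borel_Gamma
  nonempty := Filter.Eventually.of_forall fun z => (h1.nonempty_section z).image _
  isCompact := by
    filter_upwards [h2.closed_momentSet, hg] with z hc hb
    exact Metric.isCompact_of_isClosed_isBounded hc (isBounded_iff_forall_norm_le.2 ⟨g z, hb⟩)
  norm_le := hg

variable [TopologicalSpace U] [PolishSpace U] [BorelSpace U]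
  [TopologicalSpace Z] [PolishSpace Z] [BorelSpace Z]

lemma IsCompactMomentDomain.exists_isAdmissible [IsProbabilityMeasure F]
    (hG : IsCompactMomentDomain F G r g) : ∃ H, IsAdmissible F G H := by
  obtain ⟨φ, hφ, hφG⟩ := exists_measurable_selection F hG.measurableSet
    (hG.nonempty.mono fun z ⟨_, u, hu, _⟩ => ⟨u, hu⟩)
  have hm : Measurable fun z => (φ z, z) := hφ.prodMk measurable_id
  refine ⟨F.map fun z => (φ z, z), Measure.isProbabilityMeasure_map hm.aemeasurable, ?_, ?_⟩
  · exact (ae_map_iff hm.aemeasurable hG.measurableSet).2 hφG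
  · rw [Measure.map_map measurable_snd hm]
    exact Measure.map_id

lemma IsCompactMomentDomain.aemeasurable_realSupport [IsFiniteMeasure F]
    (hG : IsCompactMomentDomain F G r g) (hr : Measurable fun p : U × Z => r p.1 p.2)
    (l : EuclideanSpace ℝ (Fin d)) :
    AEMeasurable (fun z => realSupport (momentSet G r z) l) F := by
  refine NullMeasurable.aemeasurable ?_
  refine measurable_of_Ioi (mδ := NullMeasurableSpace.instMeasurableSpace (μ := F)) fun c => ?_
  have hS : MeasurableSet (G ∩ {p : U × Z | c < ⟪l, r p.1 p.2⟫}) :=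
    hG.measurableSet.inter (measurableSet_lt measurable_const (hr.const_inner))
  refine ((hS.analyticSet_image measurable_snd).nullMeasurableSet F).congr ?_
  filter_upwards [hG.nonempty, hG.isCompact] with z hne hK
  refine propext ⟨?_, fun h => ?_⟩
  · rintro ⟨⟨u, z⟩, ⟨hu, hc⟩, rfl⟩
    exact hc.trans_le (hK.inner_le_realSupport l ⟨u, hu, rfl⟩)
  · obtain ⟨_, ⟨u, hu, rfl⟩, h'⟩ := hK.exists_inner_eq_realSupport hne l
    exact ⟨(u, z), ⟨hu, (h.trans_eq h'.symm : c < ⟪l, r u z⟫)⟩, rfl⟩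

lemma IsCompactMomentDomain.integrable_realSupport [IsFiniteMeasure F]
    (hG : IsCompactMomentDomain F G r g) (hr : Measurable fun p : U × Z => r p.1 p.2)
    (hg : Integrable g F) (l : EuclideanSpace ℝ (Fin d)) :
    Integrable (fun z => realSupport (momentSet G r z) l) F := by
  refine (hg.const_mul ‖l‖).mono' (hG.aemeasurable_realSupport hr l).aestronglyMeasurable ?_
  filter_upwards [hG.nonempty, hG.isCompact, hG.norm_le] with z hne hK hb
  exact hK.abs_realSupport_le hne hb l

/-- The support restriction can be sharpened, up to null sets, to one whose moment sets are the
faces exposed by a given direction. -/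
lemma IsCompactMomentDomain.exists_exposedFace [IsFiniteMeasure F]
    (hG : IsCompactMomentDomain F G r g) (hr : Measurable fun p : U × Z => r p.1 p.2)
    (l : EuclideanSpace ℝ (Fin d)) : ∃ G' ⊆ G, IsCompactMomentDomain F G' r g ∧
      ∀ᵐ z ∂F, momentSet G' r z = exposedFace (momentSet G r z) l := by
  have hm := hG.aemeasurable_realSupport hr l
  let G' : Set (U × Z) := G ∩ {p | ⟪l, r p.1 p.2⟫ = hm.mk _ p.2}
  have hface : ∀ᵐ z ∂F, momentSet G' r z = exposedFace (momentSet G r z) l := by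
    filter_upwards [hm.ae_eq_mk] with z hz
    ext t
    constructor
    · rintro ⟨u, ⟨hu, hul⟩, rfl⟩
      exact ⟨⟨u, hu, rfl⟩, Eq.trans hul hz.symm⟩
    · rintro ⟨⟨u, hu, rfl⟩, hul⟩
      exact ⟨u, ⟨hu, hul.trans hz⟩, rfl⟩
  refine ⟨G', inter_subset_left, ⟨?_, ?_, ?_, ?_⟩, hface⟩
  · exact hG.measurableSet.inter
      (measurableSet_eq_fun hr.const_inner (hm.measurable_mk.comp measurable_snd))
  · filter_upwards [hface, hG.nonempty, hG.isCompact] with z hz hne hK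
    rw [hz]
    exact hK.exposedFace_nonempty hne l
  · filter_upwards [hface, hG.isCompact] with z hz hK
    rw [hz]
    exact hK.isCompact_exposedFace l
  · filter_upwards [hface, hG.norm_le] with z hz hb t ht
    rw [hz] at ht
    exact hb t ht.1

lemma IsAdmissible.inner_integral_le [IsFiniteMeasure F] (hH : IsAdmissible F G H)
    (hG : IsCompactMomentDomain F G r g) (hr : Measurable fun p : U × Z => r p.1 p.2)
    (hg : Integrable g F) (l : EuclideanSpace ℝ (Fin d)) :
    ⟪l, ∫ p, r p.1 p.2 ∂H⟫ ≤ ∫ z, realSupport (momentSet G r z) l ∂F := by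
  have hint := hH.integrable hG hr hg
  have hs := hG.integrable_realSupport hr hg l
  rw [← integral_inner hint l, ← hH.integral_snd hs.aestronglyMeasurable]
  refine integral_mono_ae (hint.const_inner l) ?_ ?_
  · rw [← hH.map_snd] at hs
    exact hs.comp_measurable measurable_snd
  · filter_upwards [hH.ae_snd hG.isCompact, hH.ae_mem_momentSet (r := r)] with p hK hp
    exact hK.inner_le_realSupport l hp

lemma IsAdmissible.inner_integral_eq_of_exposedFace [IsFiniteMeasure F] (hH : IsAdmissible F G' H)
    (hG : IsCompactMomentDomain F G r g) (hG' : IsCompactMomentDomain F G' r g)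
    (hr : Measurable fun p : U × Z => r p.1 p.2)
    (hg : Integrable g F) {l : EuclideanSpace ℝ (Fin d)}
    (hface : ∀ᵐ z ∂F, momentSet G' r z = exposedFace (momentSet G r z) l) :
    ⟪l, ∫ p, r p.1 p.2 ∂H⟫ = ∫ z, realSupport (momentSet G r z) l ∂F := by
  rw [← integral_inner (hH.integrable hG' hr hg) l,
    ← hH.integral_snd (hG.integrable_realSupport hr hg l).aestronglyMeasurable]
  refine integral_congr_ae ?_
  filter_upwards [hH.ae_snd hface, hH.ae_mem_momentSet (r := r)] with p hp hpm
  rw [hp] at hpm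
  exact hpm.2

/-- Nonnegativity of the integrated support function passes to the exposed face of a direction
in which it vanishes. -/
lemma IsCompactMomentDomain.integral_realSupport_exposedFace_nonneg [IsFiniteMeasure F]
    (hG : IsCompactMomentDomain F G r g) (hr : Measurable fun p : U × Z => r p.1 p.2)
    (hg : Integrable g F) {V : Submodule ℝ (EuclideanSpace ℝ (Fin d))}
    (hV : ∀ v ∈ V, 0 ≤ ∫ z, realSupport (momentSet G r z) v ∂F)
    {l : EuclideanSpace ℝ (Fin d)} (hl : l ∈ V)
    (hl0 : ∫ z, realSupport (momentSet G r z) l ∂F = 0)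
    (hface : ∀ᵐ z ∂F, momentSet G' r z = exposedFace (momentSet G r z) l)
    {v : EuclideanSpace ℝ (Fin d)} (hv : v ∈ V) :
    0 ≤ ∫ z, realSupport (momentSet G' r z) v ∂F := by
  have hint := hG.integrable_realSupport hr hg
  have hlim := tendsto_integral_of_dominated_convergence (μ := F)
    (F := fun (n : ℕ) z => ((n : ℝ) + 1) *
      (realSupport (momentSet G r z) (l + ((n : ℝ) + 1)⁻¹ • v) - realSupport (momentSet G r z) l))
    (f := fun z => realSupport (momentSet G' r z) v) (fun z => ‖v‖ * g z)
    (fun n => (((hint _).sub (hint l)).const_mul _).aestronglyMeasurable) (hg.const_mul _)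
    (fun n => by
      filter_upwards [hG.nonempty, hG.isCompact, hG.norm_le] with z hne hK hb
      have hpos : (0 : ℝ) < n + 1 := by positivity
      rw [Real.norm_eq_abs, abs_mul, abs_of_pos hpos]
      calc _ ≤ ((n : ℝ) + 1) * (‖((n : ℝ) + 1)⁻¹ • v‖ * g z) := by
            gcongr
            exact hK.abs_realSupport_add_sub_le hne hb _ _
        _ = ‖v‖ * g z := by
            rw [norm_smul, norm_inv, Real.norm_eq_abs, abs_of_pos hpos]
            field_simp)
    (by
      filter_upwards [hface, hG.nonempty, hG.isCompact] with z hz hne hK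
      rw [hz]
      exact hK.tendsto_realSupport_slope hne l v)
  refine ge_of_tendsto' hlim fun n => ?_
  rw [integral_const_mul, integral_sub (hint _) (hint _), hl0, sub_zero]
  exact mul_nonneg (by positivity) (hV _ (V.add_mem hl (V.smul_mem _ hv)))

/-- If the integrated support function is nonnegative on a subspace, some admissible law has mean
orthogonal to that subspace. -/
theorem IsCompactMomentDomain.exists_forall_inner_integral_eq_zero [IsProbabilityMeasure F]
    (hr : Measurable fun p : U × Z => r p.1 p.2) (hg : Integrable g F)
    (V : Submodule ℝ (EuclideanSpace ℝ (Fin d))) (hG : IsCompactMomentDomain F G r g)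
    (hV : ∀ v ∈ V, 0 ≤ ∫ z, realSupport (momentSet G r z) v ∂F) :
    ∃ H, IsAdmissible F G H ∧ ∀ v ∈ V, ⟪v, ∫ p, r p.1 p.2 ∂H⟫ = 0 := by
  induction V using WellFoundedLT.induction generalizing G with
  | ind V ih =>
  by_contra! hcon
  let M : Set V := {m | ∃ H, IsAdmissible F G H ∧ V.orthogonalProjectionOnto (∫ p, r p.1 p.2 ∂H) = m}
  have hMne : M.Nonempty := by
    obtain ⟨H, hH⟩ := hG.exists_isAdmissible
    exact ⟨_, H, hH, rfl⟩
  have hMconv : Convex ℝ M := by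
    rintro _ ⟨H₁, h₁, rfl⟩ _ ⟨H₂, h₂, rfl⟩ a b ha hb hab
    refine ⟨_, h₁.convexCombination h₂ ha hb hab, ?_⟩
    have hi₁ := h₁.integrable hG hr hg
    have hi₂ := h₂.integrable hG hr hg
    rw [integral_add_measure (hi₁.smul_measure ENNReal.ofReal_ne_top)
      (hi₂.smul_measure ENNReal.ofReal_ne_top), integral_smul_measure, integral_smul_measure,
      ENNReal.toReal_ofReal ha, ENNReal.toReal_ofReal hb, map_add, map_smul, map_smul]
  have hM0 : (0 : V) ∉ M := by
    rintro ⟨H, hH, h0⟩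
    obtain ⟨v, hv, hne⟩ := hcon H hH
    refine hne ?_
    have := V.inner_orthogonalProjectionOnto_eq_of_mem_left ⟨v, hv⟩ (∫ p, r p.1 p.2 ∂H)
    rw [h0, inner_zero_right] at this
    exact this.symm
  obtain ⟨⟨l, hlV⟩, hl1, hlM⟩ := hMconv.exists_norm_eq_one_forall_inner_nonpos hMne hM0
  replace hl1 : ‖l‖ = 1 := hl1
  obtain ⟨G', hsub, hG', hface⟩ := hG.exists_exposedFace hr l
  have heq : ∀ H, IsAdmissible F G' H →
      ⟪l, ∫ p, r p.1 p.2 ∂H⟫ = ∫ z, realSupport (momentSet G r z) l ∂F :=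
    fun H hH => hH.inner_integral_eq_of_exposedFace hG hG' hr hg hface
  have hl0 : ∫ z, realSupport (momentSet G r z) l ∂F = 0 := by
    obtain ⟨H, hH⟩ := hG'.exists_isAdmissible
    refine le_antisymm ?_ (hV l hlV)
    rw [← heq H hH]
    have := hlM _ ⟨H, hH.mono hsub, rfl⟩
    rwa [V.inner_orthogonalProjectionOnto_eq_of_mem_left] at this
  have hll : ⟪l, l⟫ = 1 := by rw [real_inner_self_eq_norm_sq, hl1, one_pow]
  have hlt : V ⊓ (ℝ ∙ l)ᗮ < V := by
    refine lt_of_le_of_ne inf_le_left fun h => ?_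
    have hmem : l ∈ V ⊓ (ℝ ∙ l)ᗮ := h.ge hlV
    have := Submodule.mem_orthogonal_singleton_iff_inner_right.1 hmem.2
    rw [hll] at this
    exact one_ne_zero this
  obtain ⟨H, hH, hH0⟩ := ih _ hlt hG' fun v hv =>
    hG.integral_realSupport_exposedFace_nonneg hr hg hV hlV hl0 hface hv.1
  obtain ⟨v, hv, hne⟩ := hcon H (hH.mono hsub)
  refine hne ?_
  have hw := hH0 (v - ⟪l, v⟫ • l) ⟨V.sub_mem hv (V.smul_mem _ hlV),
    Submodule.mem_orthogonal_singleton_iff_inner_right.2 (by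
      rw [inner_sub_right, inner_smul_right, hll, mul_one, sub_self])⟩
  rwa [inner_sub_left, real_inner_smul_left, heq H hH, hl0, mul_zero, sub_zero] at hw

lemma memSFSet_iff_forall_nonneg [IsFiniteMeasure F] (hG : IsCompactMomentDomain F G r g)
    (hr : Measurable fun p : U × Z => r p.1 p.2) (hg : Integrable g F) :
    MemSFSet G r F ↔ ∀ l, 0 ≤ ∫ z, realSupport (momentSet G r z) l ∂F := by
  have key : ∀ l, integralEReal F (suppFun G r l) =
      ((∫ z, realSupport (momentSet G r z) l ∂F : ℝ) : EReal) := fun l => by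
    refine integralEReal_coe (hG.integrable_realSupport hr hg l) ?_
    filter_upwards [hG.nonempty, hG.isCompact] with z hne hK
    exact suppFun_eq_coe_realSupport hne hK l
  simp only [MemSFSet, key, EReal.coe_nonneg]
  refine ⟨fun h l => ?_, fun h l _ => h l⟩
  rcases eq_or_ne l 0 with rfl | hl
  · refine (integral_eq_zero_of_ae ?_).ge
    exact hG.nonempty.mono fun z hz => realSupport_zero hz
  · have h1 := h (‖l‖⁻¹ • l) (by simp [norm_smul, hl])
    simp only [realSupport_smul_of_nonneg _ (inv_nonneg.2 (norm_nonneg l)),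
      integral_const_mul] at h1
    exact nonneg_of_mul_nonneg_right h1 (by positivity)

end Moments

/-- **Theorem 1 (sharp support-function characterization).**
Under Assumptions 1 and 2, for every `F ∈ 𝓕` and every `θ ∈ Θ`, `θ ∈ Θ_I(F)` if and only if
`∫ γ(λ,z;θ) dF ≥ 0` for all `λ` in the unit sphere `𝒮`; equivalently `Θ_I(F) = Θ̃(F)`. -/
theorem sharp_support_function {d : ℕ} (hd : 1 ≤ d)
    (𝓕 : Set (Measure 𝓩)) (hprob : ∀ F ∈ 𝓕, IsProbabilityMeasure F)
    (Γ : Θ → Set (𝓤 × 𝓩)) (r : Θ → 𝓤 → 𝓩 → EuclideanSpace ℝ (Fin d))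
    (h1 : Assumption1 𝓕 Γ r) (h2 : Assumption2 𝓕 Γ r) :
    ∀ F ∈ 𝓕, ∀ θ : Θ, MemIdentified (Γ θ) (r θ) F ↔ MemSFSet (Γ θ) (r θ) F := by
  intro F hF θ
  have := hprob F hF
  have hr := (h1 θ F hF).measurable_r
  obtain ⟨g, -, hg, hgb⟩ := (h2 θ F hF).upper_envelope
  have hG := (h1 θ F hF).isCompactMomentDomain (h2 θ F hF) hgb
  rw [memSFSet_iff_forall_nonneg hG hr hg]
  constructor
  · rintro ⟨H, hHp, hHG, hHF, -, hH0⟩ l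
    have hH : IsAdmissible F (Γ θ) H :=
      ⟨hHp, (mem_ae_iff_prob_eq_one hG.measurableSet).2 hHG, hHF⟩
    simpa [hH0] using hH.inner_integral_le hG hr hg l
  · intro h
    obtain ⟨H, hH, hH0⟩ := IsCompactMomentDomain.exists_forall_inner_integral_eq_zero hr hg ⊤ hG
      fun v _ => h v
    have := hH.isProbabilityMeasure
    exact ⟨H, this, (mem_ae_iff_prob_eq_one hG.measurableSet).1 hH.ae_mem, hH.map_snd,
      hH.integrable hG hr hg, inner_self_eq_zero.1 (hH0 _ Submodule.mem_top)⟩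

end
end

section
/- Support-function characterization of the moment closure (Theorem 2). Suppose Assumption 1 holds. Then for every F ∈ 𝓕 and every θ ∈ Θ, θ ∈ Θ̄_I(F) if and only if ∫ γ(λ,z;θ) dF ≥ 0 for all λ ∈ 𝒮; equivalently, Θ̄_I(F) = Θ̃(F). -/
open MeasureTheory Set
open scoped ENNReal RealInnerProductSpace

noncomputable section

variable {𝓤 𝓩 : Type*}
  [MeasurableSpace 𝓤] [TopologicalSpace 𝓤] [PolishSpace 𝓤] [BorelSpace 𝓤]
  [MeasurableSpace 𝓩] [TopologicalSpace 𝓩] [PolishSpace 𝓩] [BorelSpace 𝓩]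
  {Θ : Type*}

set_option linter.unusedSectionVars false

section Selection

open Filter Topology

theorem measure_toMeasurable_diff_eq_zero {α : Type*} [MeasurableSpace α] (μ : Measure α)
    [IsFiniteMeasure μ] {s t : Set α} (hst : s ⊆ t) (ht : MeasurableSet t) :
    μ (toMeasurable μ s \ t) = 0 := by
  rw [sdiff_eq, Measure.measure_toMeasurable_inter ht.compl (measure_ne_top μ s), ← sdiff_eq,
    sdiff_eq_empty.2 hst, measure_empty]

/-- The sequences of natural numbers whose first terms, listed in reverse order, form `L`. -/
def stemSet (L : List ℕ) : Set (ℕ → ℕ) := {x | PiNat.res x L.length = L}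

theorem stemSet_nil : stemSet [] = univ := by
  ext x; simp [stemSet]

theorem stemSet_eq_iUnion (L : List ℕ) : stemSet L = ⋃ n, stemSet (n :: L) := by
  ext x
  simp [stemSet, PiNat.res_succ]

/-- A measurable hull of the image of a prefix set, chosen inside its closure. -/
def stemHull (F : Measure 𝓩) (p : (ℕ → ℕ) → 𝓩) (L : List ℕ) : Set 𝓩 :=
  toMeasurable F (p '' stemSet L) ∩ closure (p '' stemSet L)

theorem measurableSet_stemHull (F : Measure 𝓩) (p : (ℕ → ℕ) → 𝓩) (L : List ℕ) :
    MeasurableSet (stemHull F p L) :=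
  (measurableSet_toMeasurable _ _).inter isClosed_closure.measurableSet

theorem image_subset_stemHull (F : Measure 𝓩) (p : (ℕ → ℕ) → 𝓩) (L : List ℕ) :
    p '' stemSet L ⊆ stemHull F p L :=
  subset_inter (subset_toMeasurable _ _) subset_closure

theorem measure_stemHull_diff (F : Measure 𝓩) [IsFiniteMeasure F] (p : (ℕ → ℕ) → 𝓩)
    (L : List ℕ) : F (stemHull F p L \ ⋃ n, stemHull F p (n :: L)) = 0 := by
  refine measure_mono_null (sdiff_subset_sdiff_left inter_subset_left)
    (measure_toMeasurable_diff_eq_zero F ?_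
      (MeasurableSet.iUnion fun n => measurableSet_stemHull F p _))
  rw [stemSet_eq_iUnion, image_iUnion]
  exact iUnion_mono fun n => image_subset_stemHull F p _

/-- The least index whose hull contains `z` among the one-term extensions of `L`. -/
def nextIndex (F : Measure 𝓩) (p : (ℕ → ℕ) → 𝓩) (L : List ℕ) (z : 𝓩) : ℕ :=
  sInf {n | z ∈ stemHull F p (n :: L)}

/-- The prefix obtained by choosing the least admissible index `k` times. -/
def selStem (F : Measure 𝓩) (p : (ℕ → ℕ) → 𝓩) (z : 𝓩) : ℕ → List ℕ
  | 0 => []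
  | k + 1 => nextIndex F p (selStem F p z k) z :: selStem F p z k

theorem measurableSet_nextIndex (F : Measure 𝓩) (p : (ℕ → ℕ) → 𝓩) (L : List ℕ) (n : ℕ) :
    MeasurableSet {z | nextIndex F p L z = n} := by
  have hle : ∀ n, MeasurableSet {z | n ≤ nextIndex F p L z} := by
    intro n
    have : {z | n ≤ nextIndex F p L z} =
        (⋂ m, (stemHull F p (m :: L))ᶜ ∩ {_z | n = 0}) ∪
        ((⋃ m, stemHull F p (m :: L)) ∩
          ⋂ (m : ℕ) (_ : m < n), (stemHull F p (m :: L))ᶜ) := by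
      ext z
      by_cases h : ∃ m, z ∈ stemHull F p (m :: L)
      · have hne : {n | z ∈ stemHull F p (n :: L)}.Nonempty := h
        have h' : ¬ ∀ m, z ∉ stemHull F p (m :: L) := by push Not; exact h
        simp only [nextIndex, mem_ofPred_eq, mem_union, mem_iInter, mem_inter_iff, mem_compl_iff,
          mem_iUnion, h, true_and, forall_and, h', false_and, false_or]
        rw [le_csInf_iff (OrderBot.bddBelow _) hne]
        exact ⟨fun H m hm hz => absurd (H m hz) (by omega),
          fun H m hz => by by_contra! hm; exact H m hm hz⟩
      · have he : {n | z ∈ stemHull F p (n :: L)} = ∅ := by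
          ext m; simpa using fun hm => h ⟨m, hm⟩
        have h' : ∀ m, z ∉ stemHull F p (m :: L) := by push Not at h; exact h
        simp [nextIndex, h']
    rw [this]
    have hm := measurableSet_stemHull F p
    exact (MeasurableSet.iInter fun m => (hm _).compl.inter (.const _)).union
      ((MeasurableSet.iUnion fun m => hm _).inter
        (MeasurableSet.iInter fun m => MeasurableSet.iInter fun _ => (hm _).compl))
  have : {z | nextIndex F p L z = n} =
      {z | n ≤ nextIndex F p L z} \ {z | n + 1 ≤ nextIndex F p L z} := by
    ext z; simp only [mem_ofPred_eq, Set.mem_sdiff]; omega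
  rw [this]
  exact (hle n).diff (hle _)

theorem measurableSet_selStem (F : Measure 𝓩) (p : (ℕ → ℕ) → 𝓩) (k : ℕ) :
    ∀ L, MeasurableSet {z | selStem F p z k = L} := by
  induction k with
  | zero => exact fun L => MeasurableSet.const ([] = L)
  | succ k ih =>
    intro L
    cases L with
    | nil => simp [selStem]
    | cons n L =>
      have : {z | selStem F p z (k + 1) = n :: L} =
          {z | selStem F p z k = L} ∩ {z | nextIndex F p L z = n} := by
        ext z
        simp only [selStem, List.cons.injEq, mem_ofPred_eq, mem_inter_iff]
        constructor
        · rintro ⟨h1, rfl⟩; exact ⟨rfl, h1⟩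
        · rintro ⟨rfl, h1⟩; exact ⟨h1, rfl⟩
      rw [this]
      exact (ih L).inter (measurableSet_nextIndex F p L n)

/-- The branch determined by the prefixes `selStem`. -/
def selBranch (F : Measure 𝓩) (p : (ℕ → ℕ) → 𝓩) (z : 𝓩) (k : ℕ) : ℕ :=
  nextIndex F p (selStem F p z k) z

theorem measurable_selBranch (F : Measure 𝓩) (p : (ℕ → ℕ) → 𝓩) :
    Measurable (selBranch F p) := by
  refine measurable_pi_lambda _ fun k => measurable_to_countable' fun n => ?_
  have : (fun z => selBranch F p z k) ⁻¹' {n} =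
      ⋃ L, {z | selStem F p z k = L} ∩ {z | nextIndex F p L z = n} := by
    ext z; simp [selBranch]
  rw [this]
  exact MeasurableSet.iUnion fun L =>
    (measurableSet_selStem F p k L).inter (measurableSet_nextIndex F p L n)

theorem res_selBranch (F : Measure 𝓩) (p : (ℕ → ℕ) → 𝓩) (z : 𝓩) (k : ℕ) :
    PiNat.res (selBranch F p z) k = selStem F p z k := by
  induction k with
  | zero => rfl
  | succ k ih => rw [PiNat.res_succ, ih]; rfl

/-- A continuous map from the Baire space to a Polish space has a measurable section
defined on a measurable set of full measure in its range. -/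
theorem exists_measurable_section (F : Measure 𝓩) [IsFiniteMeasure F] {p : (ℕ → ℕ) → 𝓩}
    (hp : Continuous p) :
    ∃ (t : 𝓩 → ℕ → ℕ) (B : Set 𝓩), Measurable t ∧ MeasurableSet B ∧ (∀ z ∈ B, p (t z) = z) ∧
      F (range p \ B) = 0 := by
  set N : Set 𝓩 := ⋃ L : List ℕ, stemHull F p L \ ⋃ n, stemHull F p (n :: L) with hN
  refine ⟨selBranch F p, stemHull F p [] \ N, measurable_selBranch F p, ?_, ?_, ?_⟩
  · exact (measurableSet_stemHull F p _).diff (MeasurableSet.iUnion fun L =>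
      (measurableSet_stemHull F p _).diff
        (MeasurableSet.iUnion fun n => measurableSet_stemHull F p _))
  · rintro z ⟨hz, hzN⟩
    have hstep : ∀ L, z ∈ stemHull F p L → ∃ n, z ∈ stemHull F p (n :: L) := by
      intro L hL
      by_contra h
      exact hzN (mem_iUnion.2 ⟨L, hL, by simpa using h⟩)
    have hmem : ∀ k, z ∈ stemHull F p (selStem F p z k) := by
      intro k
      induction k with
      | zero => exact hz
      | succ k ih => exact Nat.sInf_mem (hstep _ ih)
    have hcl : ∀ k, z ∈ closure (p '' PiNat.cylinder (selBranch F p z) k) := by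
      intro k
      have := (hmem k).2
      rwa [← res_selBranch, stemSet, PiNat.res_length, ← PiNat.cylinder_eq_res] at this
    by_contra hne
    obtain ⟨V, ⟨hV, hVc⟩, hzV⟩ := (closed_nhds_basis (p (selBranch F p z))).mem_iff.1
      (isOpen_compl_singleton.mem_nhds hne)
    have hpre := hp.continuousAt.preimage_mem_nhds hV
    obtain ⟨_, ⟨x, n, rfl⟩, hx, hxV⟩ :=
      (PiNat.isTopologicalBasis_cylinders fun _ => ℕ).mem_nhds_iff.1 hpre
    rw [← PiNat.mem_cylinder_iff_eq.1 hx] at hxV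
    exact hzV (closure_minimal (image_subset_iff.2 hxV) hVc (hcl n)) rfl
  · have h0 : F N = 0 := measure_iUnion_null fun L => measure_stemHull_diff F p L
    refine measure_mono_null ?_ h0
    rintro z ⟨hz, hzB⟩
    by_contra hzN
    refine hzB ⟨image_subset_stemHull F p [] ?_, hzN⟩
    rwa [stemSet_nil, image_univ]

/-- A Borel subset of a product of Polish spaces admits a measurable selection over almost all
of its projection. -/
theorem exists_measurable_selection_s1 [Nonempty 𝓤] (F : Measure 𝓩) [IsFiniteMeasure F]
    {A : Set (𝓤 × 𝓩)} (hA : MeasurableSet A) :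
    ∃ (s : 𝓩 → 𝓤) (B : Set 𝓩), Measurable s ∧ MeasurableSet B ∧ (∀ z ∈ B, (s z, z) ∈ A) ∧
      F (Prod.snd '' A \ B) = 0 := by
  have hA' := hA.analyticSet
  rw [AnalyticSet] at hA'
  obtain rfl | ⟨f, hf, rfl⟩ := hA'
  · exact ⟨fun _ => Classical.arbitrary 𝓤, ∅, measurable_const, .empty, by simp, by simp⟩
  · obtain ⟨t, B, ht, hB, hpt, h0⟩ := exists_measurable_section F (continuous_snd.comp hf)
    refine ⟨fun z => (f (t z)).1, B, (continuous_fst.comp hf).measurable.comp ht, hB, ?_, ?_⟩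
    · intro z hz
      exact ⟨t z, Prod.ext rfl (hpt z hz)⟩
    · rwa [← range_comp]

theorem exists_measurable_ae_selection [Nonempty 𝓤] (F : Measure 𝓩) [IsFiniteMeasure F]
    {A : Set (𝓤 × 𝓩)} (hA : MeasurableSet A) (h : ∀ᵐ z ∂F, ∃ u, (u, z) ∈ A) :
    ∃ s : 𝓩 → 𝓤, Measurable s ∧ ∀ᵐ z ∂F, (s z, z) ∈ A := by
  obtain ⟨s, B, hs, -, hsB, h0⟩ := exists_measurable_selection_s1 F hA
  refine ⟨s, hs, ?_⟩
  filter_upwards [h, measure_eq_zero_iff_ae_notMem.1 h0] with z ⟨u, hu⟩ hz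
  by_contra hzA
  exact hz ⟨⟨(u, z), hu, rfl⟩, fun hzB => hzA (hsB z hzB)⟩

theorem nullMeasurableSet_snd_image [Nonempty 𝓤] (F : Measure 𝓩) [IsFiniteMeasure F]
    {A : Set (𝓤 × 𝓩)} (hA : MeasurableSet A) : NullMeasurableSet (Prod.snd '' A) F := by
  obtain ⟨s, B, -, hB, hsB, h0⟩ := exists_measurable_selection_s1 F hA
  have hsub : B ⊆ Prod.snd '' A := fun z hz => ⟨(s z, z), hsB z hz, rfl⟩
  rw [← union_sdiff_cancel hsub]
  exact hB.nullMeasurableSet.union (NullMeasurableSet.of_null h0)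

end Selection

section MomentClosure

open Filter Topology

variable {d : ℕ} {F : Measure 𝓩} {Γθ : Set (𝓤 × 𝓩)} {rθ : 𝓤 → 𝓩 → EuclideanSpace ℝ (Fin d)}

theorem EReal.posPart_eq_toENNReal : EReal.posPart = EReal.toENNReal := by
  ext x
  by_cases h : x = ⊤ <;> simp [EReal.posPart, EReal.toENNReal, h]

theorem inner_le_suppFun {l : EuclideanSpace ℝ (Fin d)} {u : 𝓤} {z : 𝓩} (h : (u, z) ∈ Γθ) :
    ((⟪l, rθ u z⟫ : ℝ) : EReal) ≤ suppFun Γθ rθ l z :=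
  le_sSup ⟨_, ⟨u, h, rfl⟩, rfl⟩

theorem lt_suppFun_iff {l : EuclideanSpace ℝ (Fin d)} {c : EReal} {z : 𝓩} :
    c < suppFun Γθ rθ l z ↔ ∃ u, (u, z) ∈ Γθ ∧ c < ((⟪l, rθ u z⟫ : ℝ) : EReal) := by
  simp [suppFun, lt_sSup_iff, momentSet, sectionSet]

theorem measurable_inner_moment (h1 : Assumption1At F Γθ rθ) (l : EuclideanSpace ℝ (Fin d)) :
    Measurable fun p : 𝓤 × 𝓩 => (⟪l, rθ p.1 p.2⟫ : ℝ) :=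
  h1.measurable_r.const_inner

theorem aemeasurable_of_nullMeasurableSet_Ioi {γ : 𝓩 → EReal}
    (h : ∀ c, NullMeasurableSet (γ ⁻¹' Ioi c) F) : AEMeasurable γ F :=
  NullMeasurable.aemeasurable (measurable_of_Ioi (δ := NullMeasurableSpace 𝓩 F) h)

theorem aemeasurable_suppFun [Nonempty 𝓤] [IsFiniteMeasure F] (h1 : Assumption1At F Γθ rθ)
    (l : EuclideanSpace ℝ (Fin d)) : AEMeasurable (suppFun Γθ rθ l) F := by
  refine aemeasurable_of_nullMeasurableSet_Ioi fun c => ?_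
  have hA : MeasurableSet (Γθ ∩ {p : 𝓤 × 𝓩 | c < ((⟪l, rθ p.1 p.2⟫ : ℝ) : EReal)}) :=
    h1.borel_Gamma.inter
      (measurableSet_lt measurable_const (measurable_inner_moment h1 l).coe_real_ereal)
  convert nullMeasurableSet_snd_image F hA using 1
  ext z
  simp [lt_suppFun_iff]

theorem integralEReal_nonneg_iff {γ : 𝓩 → EReal} (h : ∫⁻ z, (-γ z).toENNReal ∂F ≠ ⊤) :
    0 ≤ integralEReal F γ ↔ ∫⁻ z, (-γ z).toENNReal ∂F ≤ ∫⁻ z, (γ z).toENNReal ∂F := by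
  rw [integralEReal, EReal.posPart_eq_toENNReal, EReal.sub_nonneg (Or.inr (by simpa using h))
    (Or.inr (EReal.coe_ennreal_ne_bot _)), EReal.coe_ennreal_le_coe_ennreal_iff]

/-- If `γ ∘ snd` has integrable minorants with integrals arbitrarily close to `0`, with respect
to measures having second marginal `F`, then the integral of `γ` is nonnegative. -/
theorem integralEReal_nonneg_of_minorants {γ : 𝓩 → EReal} (hγ : AEMeasurable γ F)
    (h : ∀ ε : ℝ, 0 < ε → ∃ (H : Measure (𝓤 × 𝓩)) (q : 𝓤 × 𝓩 → ℝ), H.map Prod.snd = F ∧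
      Integrable q H ∧ (∀ᵐ p ∂H, (q p : EReal) ≤ γ p.2) ∧ -ε ≤ ∫ p, q p ∂H) :
    0 ≤ integralEReal F γ := by
  have key : ∀ ε : ℝ, 0 < ε → (∫⁻ z, (-γ z).toENNReal ∂F) ≠ ⊤ ∧
      ∫⁻ z, (-γ z).toENNReal ∂F ≤ (∫⁻ z, (γ z).toENNReal ∂F) + ENNReal.ofReal ε := by
    intro ε hε
    obtain ⟨H, q, rfl, hq, hle, hint⟩ := h ε hε
    rw [lintegral_map' hγ.ereal_toENNReal measurable_snd.aemeasurable,
      lintegral_map' (f := fun z => (-γ z).toENNReal)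
        (measurable_neg.comp_aemeasurable hγ).ereal_toENNReal measurable_snd.aemeasurable]
    have hneg : ∫⁻ p, (-γ p.2).toENNReal ∂H ≤ ∫⁻ p, ENNReal.ofReal (-q p) ∂H := by
      refine lintegral_mono_ae (hle.mono fun p hp => ?_)
      rw [← EReal.real_coe_toENNReal, EReal.coe_neg]
      exact EReal.toENNReal_le_toENNReal (EReal.neg_le_neg_iff.2 hp)
    have hpos : ∫⁻ p, ENNReal.ofReal (q p) ∂H ≤ ∫⁻ p, (γ p.2).toENNReal ∂H := by
      refine lintegral_mono_ae (hle.mono fun p hp => ?_)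
      rw [← EReal.real_coe_toENNReal]
      exact EReal.toENNReal_le_toENNReal hp
    have hbtop : ∫⁻ p, ENNReal.ofReal (-q p) ∂H ≠ ⊤ := hq.neg.lintegral_lt_top.ne
    have hatop : ∫⁻ p, ENNReal.ofReal (q p) ∂H ≠ ⊤ := hq.lintegral_lt_top.ne
    refine ⟨ne_top_of_le_ne_top hbtop hneg, hneg.trans (le_trans ?_ (add_le_add_left hpos _))⟩
    rw [integral_eq_lintegral_pos_part_sub_lintegral_neg_part hq] at hint
    rw [← ENNReal.ofReal_toReal hbtop, ← ENNReal.ofReal_toReal hatop,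
      ← ENNReal.ofReal_add ENNReal.toReal_nonneg hε.le]
    exact ENNReal.ofReal_le_ofReal (by linarith)
  refine (integralEReal_nonneg_iff (key 1 one_pos).1).2
    (ENNReal.le_of_forall_pos_le_add fun ε hε _ => ?_)
  simpa using (key ε (by exact_mod_cast hε)).2

/-- A function with integrable lower bound and nonnegative integral has a finite strict minorant
whose integral is arbitrarily close to being nonnegative. -/
theorem exists_integrable_minorant [IsProbabilityMeasure F] {γ : 𝓩 → EReal}
    (hγ : AEMeasurable γ F) {g : 𝓩 → ℝ} (hg : Integrable g F)
    (hle : ∀ᵐ z ∂F, ((-g z : ℝ) : EReal) ≤ γ z) (h0 : 0 ≤ integralEReal F γ) {δ : ℝ}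
    (hδ : 0 < δ) :
    ∃ m : 𝓩 → ℝ, Measurable m ∧ Integrable m F ∧ (∀ᵐ z ∂F, (m z : EReal) < γ z) ∧
      -δ < ∫ z, m z ∂F := by
  have hnegtop : ∫⁻ z, (-γ z).toENNReal ∂F ≠ ⊤ := by
    refine ne_top_of_le_ne_top hg.lintegral_lt_top.ne (lintegral_mono_ae (hle.mono fun z hz => ?_))
    rw [← EReal.real_coe_toENNReal]
    refine EReal.toENNReal_le_toENNReal (EReal.neg_le_of_neg_le ?_)
    rwa [← EReal.coe_neg]
  rw [integralEReal_nonneg_iff hnegtop] at h0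
  set M : ℕ → 𝓩 → ℝ := fun k z => (min (γ z) ((k : ℝ) : EReal)).toReal with hM
  have hMm : ∀ k, AEMeasurable (M k) F := fun k => (hγ.min aemeasurable_const).ereal_toReal
  have hcoe : ∀ k, ∀ᵐ z ∂F, (M k z : EReal) = min (γ z) ((k : ℝ) : EReal) := by
    intro k
    filter_upwards [hle] with z hz
    refine EReal.coe_toReal (ne_top_of_le_ne_top (EReal.coe_ne_top _) (min_le_right _ _)) ?_
    exact (lt_min ((EReal.bot_lt_coe _).trans_le hz) (EReal.bot_lt_coe _)).ne'
  have hMi : ∀ k, Integrable (M k) F := by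
    intro k
    refine (hg.abs.add (integrable_const (k : ℝ))).mono' (hMm k).aestronglyMeasurable ?_
    filter_upwards [hle, hcoe k] with z hz hc
    have h1 : M k z ≤ k := by
      rw [← EReal.coe_le_coe_iff, hc]; exact min_le_right _ _
    have h2 : min (-g z) k ≤ M k z := by
      rw [← EReal.coe_le_coe_iff, hc]
      exact le_min ((EReal.coe_le_coe_iff.2 (min_le_left _ _)).trans hz)
        (EReal.coe_le_coe_iff.2 (min_le_right _ _))
    have hk : (0 : ℝ) ≤ k := k.cast_nonneg
    have h3 : -(|g z| + k) ≤ min (-g z) k :=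
      le_min (by linarith [le_abs_self (g z)]) (by linarith [abs_nonneg (g z)])
    simp only [Real.norm_eq_abs, Pi.add_apply]
    exact abs_le.2 ⟨h3.trans h2, h1.trans (by linarith [abs_nonneg (g z)])⟩
  have hposeq : ∀ k, ∫⁻ z, ENNReal.ofReal (M k z) ∂F =
      ∫⁻ z, (min (γ z) ((k : ℝ) : EReal)).toENNReal ∂F := fun k =>
    lintegral_congr_ae ((hcoe k).mono fun z hz => by
      simp only [← EReal.real_coe_toENNReal, hz])
  have hneg : ∀ k, ∫⁻ z, ENNReal.ofReal (-M k z) ∂F ≤ ∫⁻ z, (-γ z).toENNReal ∂F := by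
    refine fun k => lintegral_mono_ae ((hcoe k).mono fun z hz => ?_)
    rw [← EReal.real_coe_toENNReal, EReal.coe_neg, hz]
    rcases le_total (γ z) ((k : ℝ) : EReal) with h | h
    · rw [min_eq_left h]
    · rw [min_eq_right h, ← EReal.coe_neg, EReal.real_coe_toENNReal,
        ENNReal.ofReal_of_nonpos (by simp)]
      exact zero_le
  have htend : Tendsto (fun k => ∫⁻ z, ENNReal.ofReal (M k z) ∂F) atTop
      (𝓝 (∫⁻ z, (γ z).toENNReal ∂F)) := by
    simp only [hposeq]
    refine lintegral_tendsto_of_tendsto_of_monotone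
      (fun k => (hγ.min aemeasurable_const).ereal_toENNReal) (.of_forall fun z j k hjk => ?_)
      (.of_forall fun z => ?_)
    · refine EReal.toENNReal_le_toENNReal (min_le_min_left _ (EReal.coe_le_coe_iff.2 ?_))
      exact_mod_cast hjk
    · refine (EReal.continuous_toENNReal.tendsto _).comp ?_
      have hk : Tendsto (fun k : ℕ => ((k : ℝ) : EReal)) atTop (𝓝 ⊤) :=
        EReal.tendsto_coe_nhds_top_iff.2 tendsto_natCast_atTop_atTop
      simpa using (tendsto_const_nhds (x := γ z)).min hk
  have hδ2 : 0 < δ / 2 := half_pos hδ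
  obtain ⟨k, hk⟩ : ∃ k, ∫⁻ z, (-γ z).toENNReal ∂F <
      ∫⁻ z, ENNReal.ofReal (M k z) ∂F + ENNReal.ofReal (δ / 2) := by
    refine ((htend.add_const (ENNReal.ofReal (δ / 2))).eventually_const_lt ?_).exists
    exact (ENNReal.lt_add_right hnegtop (by simpa using hδ)).trans_le (add_le_add_left h0 _)
  have hint : -(δ / 2) < ∫ z, M k z ∂F := by
    rw [integral_eq_lintegral_pos_part_sub_lintegral_neg_part (hMi k)]
    have hatop := (hMi k).lintegral_lt_top.ne
    have := (ENNReal.toReal_lt_toReal (ne_top_of_le_ne_top hnegtop (hneg k))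
      (ENNReal.add_ne_top.2 ⟨hatop, ENNReal.ofReal_ne_top⟩)).2 ((hneg k).trans_lt hk)
    rw [ENNReal.toReal_add hatop ENNReal.ofReal_ne_top, ENNReal.toReal_ofReal hδ2.le] at this
    linarith
  have hmk := (hMm k).ae_eq_mk
  have hmki : Integrable ((hMm k).mk _) F := (hMi k).congr hmk
  refine ⟨fun z => (hMm k).mk _ z - δ / 2, (hMm k).measurable_mk.sub_const _,
    hmki.sub (integrable_const _), ?_, ?_⟩
  · filter_upwards [hmk, hcoe k] with z hz hc
    rw [← hz]
    refine lt_of_lt_of_le (EReal.coe_lt_coe_iff.2 (sub_lt_self _ hδ2)) ?_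
    rw [hc]
    exact min_le_left _ _
  · rw [integral_sub hmki (integrable_const _), ← integral_congr_ae hmk]
    simp only [integral_const, probReal_univ, one_smul]
    linarith

/-- The couplings over which the moment closure is taken. -/
def admissible (Γθ : Set (𝓤 × 𝓩)) (rθ : 𝓤 → 𝓩 → EuclideanSpace ℝ (Fin d)) (F : Measure 𝓩) :
    Set (Measure (𝓤 × 𝓩)) :=
  {H | IsProbabilityMeasure H ∧ H Γθ = 1 ∧ H.map Prod.snd = F ∧
    Integrable (fun p : 𝓤 × 𝓩 => rθ p.1 p.2) H}

/-- The mean moment values attainable by admissible couplings. -/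
def meanSet (Γθ : Set (𝓤 × 𝓩)) (rθ : 𝓤 → 𝓩 → EuclideanSpace ℝ (Fin d)) (F : Measure 𝓩) :
    Set (EuclideanSpace ℝ (Fin d)) :=
  (fun H : Measure (𝓤 × 𝓩) => ∫ p, rθ p.1 p.2 ∂H) '' admissible Γθ rθ F

theorem memMomentClosure_iff : MemMomentClosure Γθ rθ F ↔ 0 ∈ closure (meanSet Γθ rθ F) := by
  rw [Metric.mem_closure_iff]
  constructor
  · intro h ε hε
    obtain ⟨H, hp, hΓ, hm, hi, hn⟩ := h (ε / 2) (half_pos hε)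
    exact ⟨_, ⟨H, ⟨hp, hΓ, hm, hi⟩, rfl⟩, by rw [dist_zero_left]; linarith⟩
  · intro h ε hε
    obtain ⟨_, ⟨H, ⟨hp, hΓ, hm, hi⟩, rfl⟩, hn⟩ := h ε hε
    exact ⟨H, hp, hΓ, hm, hi, by rw [dist_zero_left] at hn; exact hn.le⟩

theorem convex_meanSet : Convex ℝ (meanSet Γθ rθ F) := by
  rintro _ ⟨H, ⟨hp, hΓ, hm, hi⟩, rfl⟩ _ ⟨K, ⟨kp, kΓ, km, ki⟩, rfl⟩ a b ha hb hab
  have hab' : ENNReal.ofReal a + ENNReal.ofReal b = 1 := by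
    rw [← ENNReal.ofReal_add ha hb, hab, ENNReal.ofReal_one]
  have hi' := hi.smul_measure (c := ENNReal.ofReal a) ENNReal.ofReal_ne_top
  have ki' := ki.smul_measure (c := ENNReal.ofReal b) ENNReal.ofReal_ne_top
  refine ⟨ENNReal.ofReal a • H + ENNReal.ofReal b • K, ⟨⟨?_⟩, ?_, ?_, ?_⟩, ?_⟩
  · simp [hab']
  · simp [hΓ, kΓ, hab']
  · rw [Measure.map_add _ _ measurable_snd, Measure.map_smul, Measure.map_smul, hm, km,
      ← add_smul, hab', one_smul]
  · exact hi'.add_measure ki'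
  · simp only
    rw [integral_add_measure hi' ki', integral_smul_measure, integral_smul_measure,
      ENNReal.toReal_ofReal ha, ENNReal.toReal_ofReal hb]

theorem integral_selection_mem_meanSet [IsProbabilityMeasure F] (h1 : Assumption1At F Γθ rθ)
    {s : 𝓩 → 𝓤} (hs : Measurable s) (hsΓ : ∀ᵐ z ∂F, (s z, z) ∈ Γθ)
    (hi : Integrable (fun z => rθ (s z) z) F) : ∫ z, rθ (s z) z ∂F ∈ meanSet Γθ rθ F := by
  have hsm : Measurable fun z => (s z, z) := hs.prodMk measurable_id
  have hr {μ : Measure (𝓤 × 𝓩)} := h1.measurable_r.aestronglyMeasurable (μ := μ)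
  refine ⟨F.map fun z => (s z, z),
    ⟨Measure.isProbabilityMeasure_map hsm.aemeasurable, ?_, ?_, ?_⟩, ?_⟩
  · rw [Measure.map_apply hsm h1.borel_Gamma]
    exact (prob_compl_eq_zero_iff (hsm h1.borel_Gamma)).1 hsΓ
  · rw [Measure.map_map measurable_snd hsm]
    exact Measure.map_id
  · exact (integrable_map_measure hr hsm.aemeasurable).2 hi
  · exact integral_map hsm.aemeasurable hr

theorem exists_integrable_selection [Nonempty 𝓤] [IsProbabilityMeasure F]
    (h1 : Assumption1At F Γθ rθ) :
    ∃ (s : 𝓩 → 𝓤) (g : 𝓩 → ℝ), Measurable s ∧ Measurable g ∧ Integrable g F ∧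
      ∀ᵐ z ∂F, (s z, z) ∈ Γθ ∧ ‖rθ (s z) z‖ ≤ g z := by
  obtain ⟨g, hgm, hgi, hg⟩ := h1.lower_envelope
  obtain ⟨s, hs, hsA⟩ := exists_measurable_ae_selection F
    (A := Γθ ∩ {p : 𝓤 × 𝓩 | ‖rθ p.1 p.2‖ ≤ g p.2 + 1})
    (h1.borel_Gamma.inter (measurableSet_le h1.measurable_r.norm
      ((hgm.comp measurable_snd).add_const 1)))
    (by
      filter_upwards [hg] with z hz
      obtain ⟨_, ⟨_, ⟨u, hu, rfl⟩, rfl⟩, hlt⟩ := exists_lt_of_csInf_lt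
        (((h1.nonempty_section z).image _).image _) (hz.trans_lt (lt_add_one (g z)))
      exact ⟨u, hu, hlt.le⟩)
  exact ⟨s, fun z => g z + 1, hs, hgm.add_const 1, hgi.add (integrable_const 1), hsA⟩

theorem exists_mem_meanSet_inner_gt [Nonempty 𝓤] [IsProbabilityMeasure F]
    (h1 : Assumption1At F Γθ rθ) {l : EuclideanSpace ℝ (Fin d)} (hl : ‖l‖ = 1)
    (h0 : 0 ≤ integralEReal F (suppFun Γθ rθ l)) {δ : ℝ} (hδ : 0 < δ) :
    ∃ x ∈ meanSet Γθ rθ F, -δ < (⟪l, x⟫ : ℝ) := by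
  obtain ⟨s₀, g, hs₀, hgm, hgi, hs₀g⟩ := exists_integrable_selection h1
  have hbound : ∀ x : EuclideanSpace ℝ (Fin d), -‖x‖ ≤ (⟪l, x⟫ : ℝ) := fun x => by
    have := abs_real_inner_le_norm l x
    rw [hl, one_mul] at this
    exact (abs_le.1 this).1
  have hgγ : ∀ᵐ z ∂F, ((-g z : ℝ) : EReal) ≤ suppFun Γθ rθ l z := by
    filter_upwards [hs₀g] with z ⟨hz, hzg⟩
    exact (EReal.coe_le_coe_iff.2 ((neg_le_neg hzg).trans (hbound _))).trans (inner_le_suppFun hz)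
  obtain ⟨m, hmm, hmi, hmγ, hm⟩ :=
    exists_integrable_minorant (aemeasurable_suppFun h1 l) hgi hgγ h0 hδ
  obtain ⟨s₁, hs₁, hs₁A⟩ := exists_measurable_ae_selection F
    (A := Γθ ∩ {p : 𝓤 × 𝓩 | m p.2 ≤ ⟪l, rθ p.1 p.2⟫})
    (h1.borel_Gamma.inter
      (measurableSet_le (hmm.comp measurable_snd) (measurable_inner_moment h1 l)))
    (by
      filter_upwards [hmγ] with z hz
      obtain ⟨u, hu, hlt⟩ := lt_suppFun_iff.1 hz
      exact ⟨u, hu, (EReal.coe_lt_coe_iff.1 hlt).le⟩)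
  have hr {s : 𝓩 → 𝓤} (hs : Measurable s) : Measurable fun z => rθ (s z) z :=
    h1.measurable_r.comp (hs.prodMk measurable_id)
  set S : ℕ → Set 𝓩 := fun n => {z | ‖rθ (s₁ z) z‖ ≤ n} with hS
  have hSm : ∀ n, MeasurableSet (S n) := fun n =>
    measurableSet_le (hr hs₁).norm measurable_const
  classical
  set lo : ℕ → 𝓩 → ℝ := fun n => (S n).piecewise m fun z => -g z with hlo
  have hlom : ∀ n, Measurable (lo n) := fun n => hmm.piecewise (hSm n) hgm.neg
  have hlob : ∀ n, ∀ z, ‖lo n z‖ ≤ |m z| + |g z| := by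
    intro n z
    by_cases hz : z ∈ S n <;> simp [hlo, hz]
  have hbi : Integrable (fun z => |m z| + |g z|) F := hmi.abs.add hgi.abs
  have htend : Tendsto (fun n => ∫ z, lo n z ∂F) atTop (𝓝 (∫ z, m z ∂F)) := by
    refine tendsto_integral_of_dominated_convergence _
      (fun n => (hlom n).aestronglyMeasurable) hbi (fun n => .of_forall (hlob n))
      (.of_forall fun z => tendsto_const_nhds.congr' ?_)
    filter_upwards [eventually_ge_atTop ⌈‖rθ (s₁ z) z‖⌉₊] with n hn
    have hz : z ∈ S n := (Nat.le_ceil _).trans (Nat.cast_le.2 hn)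
    simp [hlo, hz]
  obtain ⟨n, hn⟩ := (htend.eventually_const_lt hm).exists
  have hs : Measurable ((S n).piecewise s₁ s₀) := hs₁.piecewise (hSm n) hs₀
  have hi : Integrable (fun z => rθ ((S n).piecewise s₁ s₀ z) z) F := by
    refine (hgi.abs.add (integrable_const (n : ℝ))).mono' (hr hs).aestronglyMeasurable ?_
    filter_upwards [hs₀g] with z ⟨_, hzg⟩
    by_cases hz : z ∈ S n
    · simp only [hz, piecewise_eq_of_mem, Pi.add_apply]
      exact le_add_of_nonneg_of_le (abs_nonneg _) hz
    · simp only [hz, not_false_eq_true, piecewise_eq_of_notMem, Pi.add_apply]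
      exact le_add_of_le_of_nonneg (hzg.trans (le_abs_self _)) n.cast_nonneg
  refine ⟨_, integral_selection_mem_meanSet h1 hs ?_ hi, ?_⟩
  · filter_upwards [hs₀g, hs₁A] with z hz₀ hz₁
    by_cases hz : z ∈ S n
    · simpa [hz] using hz₁.1
    · simpa [hz] using hz₀.1
  · rw [← integral_inner hi]
    refine hn.trans_le (integral_mono_ae (hbi.mono' (hlom n).aestronglyMeasurable
      (.of_forall (hlob n))) (hi.const_inner l) ?_)
    filter_upwards [hs₀g, hs₁A] with z hz₀ hz₁
    by_cases hz : z ∈ S n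
    · simpa [hlo, hz] using hz₁.2
    · simpa [hlo, hz] using (neg_le_neg hz₀.2).trans (hbound _)

theorem memSFSet_of_memMomentClosure [Nonempty 𝓤] [IsProbabilityMeasure F]
    (h1 : Assumption1At F Γθ rθ) (h : MemMomentClosure Γθ rθ F) : MemSFSet Γθ rθ F := by
  intro l hl
  refine integralEReal_nonneg_of_minorants (𝓤 := 𝓤) (aemeasurable_suppFun h1 l) fun ε hε => ?_
  obtain ⟨H, hp, hΓ, hm, hi, hn⟩ := h ε hε
  refine ⟨H, fun p => ⟪l, rθ p.1 p.2⟫, hm, hi.const_inner l, ?_, ?_⟩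
  · have : ∀ᵐ p ∂H, p ∈ Γθ := (prob_compl_eq_zero_iff h1.borel_Gamma).2 hΓ
    exact this.mono fun p hp => inner_le_suppFun hp
  · rw [integral_inner hi]
    have := abs_real_inner_le_norm l (∫ p, rθ p.1 p.2 ∂H)
    rw [hl, one_mul] at this
    exact (abs_le.1 (this.trans hn)).1

theorem memMomentClosure_of_memSFSet [Nonempty 𝓤] [IsProbabilityMeasure F]
    (h1 : Assumption1At F Γθ rθ) (h : MemSFSet Γθ rθ F) : MemMomentClosure Γθ rθ F := by
  rw [memMomentClosure_iff]
  by_contra h0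
  obtain ⟨f, c, hlt, hc⟩ :=
    geometric_hahn_banach_closed_point convex_meanSet.closure isClosed_closure h0
  rw [map_zero] at hc
  set v := (InnerProductSpace.toDual ℝ (EuclideanSpace ℝ (Fin d))).symm f with hv
  have hfv : ∀ x, f x = ⟪v, x⟫ := fun x => by
    rw [hv, InnerProductSpace.toDual_symm_apply]
  obtain ⟨s, g, hs, hgm, hgi, hsg⟩ := exists_integrable_selection h1
  have hmem := integral_selection_mem_meanSet h1 hs (hsg.mono fun z hz => hz.1)
    (hgi.mono' (h1.measurable_r.comp (hs.prodMk measurable_id)).aestronglyMeasurable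
      (hsg.mono fun z hz => hz.2))
  have hv0 : v ≠ 0 := by
    intro hv0
    have := (hlt _ (subset_closure hmem)).trans hc
    rw [hfv, hv0, inner_zero_left] at this
    exact this.false
  have hvpos : 0 < ‖v‖ := norm_pos_iff.2 hv0
  have hl : ‖‖v‖⁻¹ • v‖ = 1 := norm_smul_inv_norm hv0
  obtain ⟨x, hx, hxc⟩ := exists_mem_meanSet_inner_gt h1 hl (h _ hl)
    (δ := ‖v‖⁻¹ * -c) (mul_pos (inv_pos.2 hvpos) (neg_pos.2 hc))
  have := hlt x (subset_closure hx)
  rw [real_inner_smul_left, mul_neg, neg_neg, mul_lt_mul_iff_right₀ (inv_pos.2 hvpos),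
    ← hfv] at hxc
  exact (hxc.trans this).false

end MomentClosure

/-- **Theorem 2 (support-function characterization of the moment closure).**
Under Assumption 1, for every `F ∈ 𝓕` and every `θ ∈ Θ`, `θ ∈ Θ̄_I(F)` if and only if
`∫ γ(λ,z;θ) dF ≥ 0` for all `λ` in the unit sphere `𝒮`; equivalently `Θ̄_I(F) = Θ̃(F)`. -/
theorem moment_closure_support_function {d : ℕ} (hd : 1 ≤ d)
    (𝓕 : Set (Measure 𝓩)) (hprob : ∀ F ∈ 𝓕, IsProbabilityMeasure F)
    (Γ : Θ → Set (𝓤 × 𝓩)) (r : Θ → 𝓤 → 𝓩 → EuclideanSpace ℝ (Fin d))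
    (h1 : Assumption1 𝓕 Γ r) :
    ∀ F ∈ 𝓕, ∀ θ : Θ, MemMomentClosure (Γ θ) (r θ) F ↔ MemSFSet (Γ θ) (r θ) F := by
  intro F hF θ
  have := hprob F hF
  have h1F := h1 θ F hF
  have : Nonempty 𝓩 := nonempty_of_isProbabilityMeasure F
  have : Nonempty 𝓤 := (h1F.nonempty_section (Classical.arbitrary 𝓩)).nonempty
  exact ⟨memSFSet_of_memMomentClosure h1F, memMomentClosure_of_memSFSet h1F⟩

end
end

section
/- Irreducibility implies finite-sample indistinguishability (Theorem 3). Suppose Assumption 1 holds, 𝓕 is convex, r₁(·;θ) is F-integrable for every F ∈ 𝓕 and θ ∈ Θ, and the model (Γ,r) is irreducible. Then for every θ ∈ Θ, the hypothesis θ ∈ Θ_I(F) is impossible to distinguish from the hypothesis θ ∈ Θ̄_I(F) in finite samples. -/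
open MeasureTheory Set
open scoped ENNReal RealInnerProductSpace

noncomputable section

variable {𝓤 𝓩 : Type*}
  [MeasurableSpace 𝓤] [TopologicalSpace 𝓤] [PolishSpace 𝓤] [BorelSpace 𝓤]
  [MeasurableSpace 𝓩] [TopologicalSpace 𝓩] [PolishSpace 𝓩] [BorelSpace 𝓩]
  {Θ : Type*}

/-- The combined moment function `r(u,z;θ) = (r₁(z;θ), r₂(u,z;θ))`, where `r₁` collects the
components that do not depend on the latent variable `u`. -/
def rComb {d1 d2 : ℕ} (r1θ : 𝓩 → EuclideanSpace ℝ (Fin d1))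
    (r2θ : 𝓤 → 𝓩 → EuclideanSpace ℝ (Fin d2)) (u : 𝓤) (z : 𝓩) :
    EuclideanSpace ℝ (Fin (d1 + d2)) :=
  (EuclideanSpace.equiv (Fin (d1 + d2)) ℝ).symm
    (Fin.append (EuclideanSpace.equiv (Fin d1) ℝ (r1θ z))
      (EuclideanSpace.equiv (Fin d2) ℝ (r2θ u z)))

/-- The partial support function `γ₂(λ,z;θ) = sup {λᵀ r₂(u,z;θ) : u ∈ Γ(z;θ)}`. -/
def suppFun2 {d2 : ℕ} (Γθ : Set (𝓤 × 𝓩)) (r2θ : 𝓤 → 𝓩 → EuclideanSpace ℝ (Fin d2))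
    (l : EuclideanSpace ℝ (Fin d2)) (z : 𝓩) : EReal :=
  sSup ((fun u => ((⟪l, r2θ u z⟫ : ℝ) : EReal)) '' sectionSet Γθ z)

/-- Convexity of a family of (probability) measures. -/
def ConvexFamily (𝓕 : Set (Measure 𝓩)) : Prop :=
  ∀ F₁ ∈ 𝓕, ∀ F₂ ∈ 𝓕, ∀ δ : ℝ, 0 ≤ δ → δ ≤ 1 →
    (ENNReal.ofReal δ • F₁ + ENNReal.ofReal (1 - δ) • F₂) ∈ 𝓕

/-- Finite-sample indistinguishability of the hypotheses `θ ∈ Θ_I(F)` and `θ ∈ Θ̄_I(F)`: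
for every sample size `n` and every (measurable, `[0,1]`-valued) test `φ`, the supremum of the
rejection probability over `𝓕_θ` equals the supremum over `𝓕̄_θ`. -/
def Indistinguishable {d : ℕ} (𝓕 : Set (Measure 𝓩)) (Γθ : Set (𝓤 × 𝓩))
    (rθ : 𝓤 → 𝓩 → EuclideanSpace ℝ (Fin d)) : Prop :=
  ∀ (n : ℕ) (φ : (Fin n → 𝓩) → ℝ), Measurable φ → (∀ x, φ x ∈ Set.Icc (0 : ℝ) 1) →
    sSup ((fun F : Measure 𝓩 => ∫ x, φ x ∂(Measure.pi fun _ : Fin n => F)) ''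
        {F ∈ 𝓕 | MemIdentified Γθ rθ F}) =
      sSup ((fun F : Measure 𝓩 => ∫ x, φ x ∂(Measure.pi fun _ : Fin n => F)) ''
        {F ∈ 𝓕 | MemMomentClosure Γθ rθ F})

/-- The support restriction of the reduced model: the subset of `Γ(θ)` on which
`λ₁ᵀ r₂(u,z;θ)` attains the support-function value `γ₂(λ₁,z;θ)`. -/
def redGamma {d2 : ℕ} (Γθ : Set (𝓤 × 𝓩)) (r2θ : 𝓤 → 𝓩 → EuclideanSpace ℝ (Fin d2))
    (l1 : EuclideanSpace ℝ (Fin d2)) : Set (𝓤 × 𝓩) :=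
  {p ∈ Γθ | ((⟪l1, r2θ p.1 p.2⟫ : ℝ) : EReal) = suppFun2 Γθ r2θ l1 p.2}

/-- The moment function of the reduced model:
`r̃(u,z;θ) = (r₁(z;θ), γ₂(λ₁,z;θ), λ₂ᵀ r₂(u,z;θ), …, λ_{dim r₂}ᵀ r₂(u,z;θ))`. -/
def redR {d1 d2 : ℕ} (Γθ : Set (𝓤 × 𝓩)) (r1θ : 𝓩 → EuclideanSpace ℝ (Fin d1))
    (r2θ : 𝓤 → 𝓩 → EuclideanSpace ℝ (Fin d2)) (h : 0 < d2)
    (lam : Fin d2 → EuclideanSpace ℝ (Fin d2)) (u : 𝓤) (z : 𝓩) :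
    EuclideanSpace ℝ (Fin (d1 + d2)) :=
  (EuclideanSpace.equiv (Fin (d1 + d2)) ℝ).symm
    (Fin.append (EuclideanSpace.equiv (Fin d1) ℝ (r1θ z))
      (fun i : Fin d2 =>
        if (i : ℕ) = 0 then (suppFun2 Γθ r2θ (lam ⟨0, h⟩) z).toReal
        else ⟪lam i, r2θ u z⟫))

/-- The model `(Γ, r)` with `r = (r₁, r₂)` is reducible: at some `θ` there exist
`dim r₂` linearly independent vectors `λ₁, …, λ_{dim r₂}` such that the corresponding
reduced model has the same identified set as `(Γ, r)` for every `F ∈ 𝓕`. -/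
def Reducible {d1 d2 : ℕ} (𝓕 : Set (Measure 𝓩)) (Γ : Θ → Set (𝓤 × 𝓩))
    (r1 : Θ → 𝓩 → EuclideanSpace ℝ (Fin d1))
    (r2 : Θ → 𝓤 → 𝓩 → EuclideanSpace ℝ (Fin d2)) : Prop :=
  ∃ (θ : Θ) (h : 0 < d2) (lam : Fin d2 → EuclideanSpace ℝ (Fin d2)),
    LinearIndependent ℝ lam ∧
    ∀ F ∈ 𝓕, (MemIdentified (Γ θ) (rComb (r1 θ) (r2 θ)) F ↔
      MemIdentified (redGamma (Γ θ) (r2 θ) (lam ⟨0, h⟩)) (redR (Γ θ) (r1 θ) (r2 θ) h lam) F)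

/-- A set of points of Baire space whose coordinates are bounded one by one is approximated by
the sets in which only finitely many coordinates are bounded. -/
theorem exists_forall_lt_subset_of_isOpen (b : ℕ → ℕ) {V : Set (ℕ → ℕ)} (hV : IsOpen V)
    (hb : univ.pi (fun i => Iic (b i)) ⊆ V) :
    ∃ k : ℕ, {x : ℕ → ℕ | ∀ i < k, x i ≤ b i} ⊆ V := by
  by_contra! h
  simp only [not_subset] at h
  choose x hx hxV using h
  have hK : IsCompact (univ.pi fun i => Iic (b i)) :=
    isCompact_univ_pi fun i => (finite_Iic (b i)).isCompact
  obtain ⟨a, haK, φ, hφ, hlim⟩ := hK.isSeqCompact (x := fun k i => min (x k i) (b i))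
    (fun k i _ => mem_Iic.2 (min_le_right _ _))
  have hlim' : Filter.Tendsto (x ∘ φ) Filter.atTop (nhds a) := by
    rw [tendsto_pi_nhds] at hlim ⊢
    intro i
    refine (hlim i).congr' ?_
    filter_upwards [Filter.eventually_gt_atTop i] with k hk
    exact min_eq_left (hx (φ k) i (hk.trans_le hφ.le_apply))
  obtain ⟨k, hk⟩ := (hlim'.eventually (hV.mem_nhds (hb haK))).exists
  exact hxV _ hk

/-- **Capacitability**: if a continuous image of Baire space has positive outer measure, then so
has the image of some compact set. -/
theorem exists_isCompact_measure_image_pos {X : Type*} [TopologicalSpace X] [MeasurableSpace X]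
    (μ : Measure X) [μ.OuterRegular] {f : (ℕ → ℕ) → X} (hf : Continuous f)
    (h : μ (range f) ≠ 0) : ∃ K : Set (ℕ → ℕ), IsCompact K ∧ μ (f '' K) ≠ 0 := by
  obtain ⟨a, ha0, ha⟩ := exists_between (pos_iff_ne_zero.2 h)
  have step : ∀ (k : ℕ) (E : {E : Set (ℕ → ℕ) // a < μ (f '' E)}),
      ∃ m : ℕ, a < μ (f '' (E.1 ∩ {x | x k ≤ m})) := by
    intro k E
    have hmono : Monotone fun m : ℕ => f '' (E.1 ∩ {x | x k ≤ m}) := fun m n hmn =>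
      image_mono (inter_subset_inter_right _ fun x hx => le_trans hx hmn)
    have hU : ⋃ m : ℕ, f '' (E.1 ∩ {x | x k ≤ m}) = f '' E.1 := by
      rw [← image_iUnion, ← inter_iUnion, iUnion_eq_univ_iff.2 fun x => ⟨x k, le_refl (x k)⟩, inter_univ]
    have := E.2
    rwa [← hU, hmono.measure_iUnion, lt_iSup_iff] at this
  choose m hm using step
  let E : ℕ → {E : Set (ℕ → ℕ) // a < μ (f '' E)} := fun k =>
    Nat.rec ⟨univ, by rwa [image_univ]⟩ (fun k E => ⟨E.1 ∩ {x | x k ≤ m k E}, hm k E⟩) k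
  let b : ℕ → ℕ := fun k => m k (E k)
  have hE : ∀ k, (E k).1 = {x | ∀ i < k, x i ≤ b i} := by
    intro k
    induction k with
    | zero => simp [E]
    | succ k ih =>
      have : (E (k + 1)).1 = (E k).1 ∩ {x | x k ≤ b k} := rfl
      rw [this, ih]
      ext x
      simp only [mem_inter_iff, mem_ofPred_eq, Nat.lt_succ_iff_lt_or_eq, or_imp, forall_and,
        forall_eq]
  refine ⟨univ.pi fun i => Iic (b i),
    isCompact_univ_pi fun i => (finite_Iic (b i)).isCompact, ne_of_gt (ha0.trans_le ?_)⟩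
  rw [measure_eq_iInf_isOpen]
  refine le_iInf₂ fun U hU => le_iInf fun hUo => ?_
  obtain ⟨k, hk⟩ := exists_forall_lt_subset_of_isOpen b (hUo.preimage hf) (image_subset_iff.1 hU)
  rw [← hE] at hk
  exact (E k).2.le.trans (measure_mono (image_subset_iff.2 hk))

/-- A continuous map from the Cantor set has a Borel right inverse on its range. -/
theorem exists_measurable_rightInverse_of_cantorSet {X : Type*} [TopologicalSpace X] [T2Space X]
    [MeasurableSpace X] [BorelSpace X] {p : cantorSet → X} (hp : Continuous p) :
    ∃ τ : X → cantorSet, Measurable τ ∧ ∀ y ∈ range p, p (τ y) = y := by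
  have : CompactSpace cantorSet := isCompact_iff_compactSpace.1 isCompact_cantorSet
  let T : X → Set ℝ := fun y => (↑) '' (p ⁻¹' {y})
  have hT0 : ∀ y, y ∉ range p → T y = ∅ := fun y hy => by
    rw [image_eq_empty, eq_empty_iff_forall_notMem]
    exact fun t ht => hy ⟨t, ht⟩
  have hTc : ∀ y, IsCompact (T y) := fun y =>
    ((isClosed_singleton.preimage hp).isCompact).image continuous_subtype_val
  have hTmem : ∀ y ∈ range p, sInf (T y) ∈ T y := by
    rintro _ ⟨t, rfl⟩
    exact (hTc _).sInf_mem ⟨t, t, rfl, rfl⟩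
  have hmem : ∀ y, sInf (T y) ∈ cantorSet := by
    intro y
    by_cases hy : y ∈ range p
    · obtain ⟨t, -, ht⟩ := hTmem y hy
      exact ht ▸ t.2
    · rw [hT0 y hy, Real.sInf_empty]
      exact zero_mem_cantorSet
  have hrange : MeasurableSet (range p) := (isCompact_range hp).isClosed.measurableSet
  have hmeas : Measurable fun y => sInf (T y) := by
    refine measurable_of_Iic fun c => ?_
    have hc : MeasurableSet (p '' {t | (t : ℝ) ≤ c}) :=
      ((isClosed_le continuous_subtype_val continuous_const).isCompact.image hp).isClosed.measurableSet
    have : (fun y => sInf (T y)) ⁻¹' Iic c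
        = p '' {t | (t : ℝ) ≤ c} ∪ ((range p)ᶜ ∩ {_y | 0 ≤ c}) := by
      ext y
      by_cases hy : y ∈ range p
      · simp only [mem_preimage, mem_Iic, mem_union, mem_inter_iff, mem_compl_iff, hy,
          not_true_eq_false, false_and, or_false]
        constructor
        · intro h
          obtain ⟨t, ht, hts⟩ := hTmem y hy
          exact ⟨t, hts.le.trans h, ht⟩
        · rintro ⟨t, ht, rfl⟩
          exact (csInf_le (hTc _).bddBelow ⟨t, rfl, rfl⟩).trans ht
      · have hy' : y ∉ p '' {t | (t : ℝ) ≤ c} := fun h => hy (image_subset_range _ _ h)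
        simp [hT0 y hy, hy', hy]
    rw [this]
    exact hc.union (hrange.compl.inter (MeasurableSet.const _))
  refine ⟨fun y => ⟨sInf (T y), hmem y⟩, hmeas.subtype_mk, fun y hy => ?_⟩
  obtain ⟨t, ht, hts⟩ := hTmem y hy
  have : (⟨sInf (T y), hmem y⟩ : cantorSet) = t := Subtype.ext hts.symm
  exact (congrArg p this).trans ht

/-- A Borel set whose projection has positive outer measure contains the graph of a Borel map
over a Borel set of positive measure. -/
theorem MeasurableSet.exists_measurable_selection {X Y : Type*}
    [TopologicalSpace X] [PolishSpace X] [MeasurableSpace X] [BorelSpace X]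
    [TopologicalSpace Y] [PolishSpace Y] [MeasurableSpace Y] [BorelSpace Y]
    (μ : Measure X) [IsFiniteMeasure μ] {S : Set (X × Y)} (hS : MeasurableSet S)
    (h : μ (Prod.fst '' S) ≠ 0) :
    ∃ (B : Set X) (s : X → Y), MeasurableSet B ∧ μ B ≠ 0 ∧ Measurable s ∧
      ∀ x ∈ B, (x, s x) ∈ S := by
  have hA := hS.analyticSet
  rw [AnalyticSet] at hA
  obtain rfl | ⟨f, hf, rfl⟩ := hA
  · simp at h
  rw [← range_comp] at h
  obtain ⟨K, hK, hμK⟩ := exists_isCompact_measure_image_pos μ (continuous_fst.comp hf) h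
  have hne : Nonempty K := by
    by_contra hne
    rw [nonempty_coe_sort, not_nonempty_iff_eq_empty] at hne
    simp [hne] at hμK
  have : CompactSpace K := isCompact_iff_compactSpace.1 hK
  let _ : MetricSpace K := TopologicalSpace.metrizableSpaceMetric K
  obtain ⟨ψ, hψ, hψs⟩ := exists_nat_bool_continuous_surjective_of_compact K
  let q : cantorSet → X × Y := fun t => f (ψ (cantorSetHomeomorphNatToBool t))
  have hq : Continuous q := hf.comp
    (continuous_subtype_val.comp (hψ.comp cantorSetHomeomorphNatToBool.continuous))
  have hr : range (fun t => (q t).1) = (Prod.fst ∘ f) '' K := by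
    ext y
    constructor
    · rintro ⟨t, rfl⟩
      exact ⟨_, (ψ _).2, rfl⟩
    · rintro ⟨x, hx, rfl⟩
      obtain ⟨c, hc⟩ := hψs ⟨x, hx⟩
      exact ⟨cantorSetHomeomorphNatToBool.symm c, by simp [q, hc]⟩
  obtain ⟨τ, hτ, hτr⟩ := exists_measurable_rightInverse_of_cantorSet (continuous_fst.comp hq)
  refine ⟨(Prod.fst ∘ f) '' K, fun x => (q (τ x)).2, ?_, hμK,
    (continuous_snd.comp hq).measurable.comp hτ, fun x hx => ?_⟩
  · exact (hK.image (continuous_fst.comp hf)).isClosed.measurableSet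
  · rw [← hr] at hx
    refine ⟨ψ (cantorSetHomeomorphNatToBool (τ x)), ?_⟩
    exact Prod.ext (hτr x hx) rfl

/-- A finite measure dominating a multiple of another one has product powers dominating the
corresponding multiples. -/
theorem smul_pi_le_pi {X : Type*} [MeasurableSpace X] {ι : Type*} [Fintype ι]
    {μ ν : Measure X} [SigmaFinite μ] {c : ℝ≥0∞} (h : c • μ ≤ ν) :
    c ^ Fintype.card ι • Measure.pi (fun _ : ι => μ) ≤ Measure.pi fun _ : ι => ν := by
  refine Measure.le_iff.2 fun s hs => ?_
  rw [Measure.pi_def (fun _ : ι => ν), toMeasure_apply _ _ hs]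
  have key : (c ^ Fintype.card ι • Measure.pi fun _ : ι => μ).toOuterMeasure ≤
      OuterMeasure.pi fun _ : ι => ν.toOuterMeasure := by
    refine OuterMeasure.le_pi.2 fun t _ => ?_
    have : (c ^ Fintype.card ι • Measure.pi fun _ : ι => μ) (univ.pi t) = ∏ i, (c • μ) (t i) := by
      simp [Measure.pi_pi, Finset.prod_mul_distrib]
    exact this.le.trans (Finset.prod_le_prod' fun i _ => h (t i))
  exact key s

/-- A convex set that is not a neighbourhood of the origin lies in a half-space whose boundary
passes through the origin. -/
theorem Convex.exists_inner_nonpos_of_zero_notMem_interior {E : Type*} [NormedAddCommGroup E]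
    [InnerProductSpace ℝ E] [FiniteDimensional ℝ E] [Nontrivial E] {C : Set E} (hC : Convex ℝ C)
    (h : (0 : E) ∉ interior C) : ∃ l : E, l ≠ 0 ∧ ∀ m ∈ C, ⟪l, m⟫ ≤ 0 := by
  obtain rfl | ⟨m₀, hm₀⟩ := C.eq_empty_or_nonempty
  · obtain ⟨l, hl⟩ := exists_ne (0 : E)
    exact ⟨l, hl, by simp⟩
  by_cases hint : (interior C).Nonempty
  · obtain ⟨f, hf0, hf⟩ := geometric_hahn_banach_of_nonempty_interior_point hC h hint
    refine ⟨(InnerProductSpace.toDual ℝ E).symm f, by simpa using hf0, fun m hm => ?_⟩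
    simpa using hf m hm
  · rw [hC.interior_nonempty_iff_affineSpan_eq_top] at hint
    have hdir : vectorSpan ℝ C ≠ ⊤ := fun h => hint <|
      (AffineSubspace.affineSpan_eq_top_iff_vectorSpan_eq_top_of_nonempty ℝ E E ⟨m₀, hm₀⟩).2 h
    rw [ne_eq, ← Submodule.orthogonal_eq_bot_iff] at hdir
    obtain ⟨l, hl, hl0⟩ := Submodule.exists_mem_ne_zero_of_ne_bot hdir
    have hconst : ∀ m ∈ C, ⟪l, m⟫ = ⟪l, m₀⟫ := fun m hm => by
      have := (Submodule.mem_orthogonal' _ _).1 hl _ (vsub_mem_vectorSpan ℝ hm hm₀)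
      rwa [vsub_eq_sub, inner_sub_right, sub_eq_zero] at this
    rcases le_total ⟪l, m₀⟫ 0 with hle | hle
    · exact ⟨l, hl0, fun m hm => (hconst m hm).trans_le hle⟩
    · refine ⟨-l, neg_ne_zero.2 hl0, fun m hm => ?_⟩
      rw [inner_neg_left, hconst m hm]
      linarith

/-- Every nonzero vector of `ℝᵈ` is the first vector of a basis. -/
theorem exists_linearIndependent_apply_zero_eq {d : ℕ} (hd : 0 < d) {l : EuclideanSpace ℝ (Fin d)}
    (hl : l ≠ 0) :
    ∃ lam : Fin d → EuclideanSpace ℝ (Fin d), LinearIndependent ℝ lam ∧ lam ⟨0, hd⟩ = l := by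
  let e := EuclideanSpace.basisFun (Fin d) ℝ
  obtain ⟨A, hA⟩ := SeparatingDual.exists_continuousLinearEquiv_apply_eq (R := ℝ)
    (e.toBasis.ne_zero ⟨0, hd⟩) hl
  exact ⟨fun i => A (e.toBasis i),
    e.toBasis.linearIndependent.map' A.toLinearMap (LinearMap.ker_eq_bot.2 A.injective), hA⟩

/-- Concatenation of coordinates, as a linear equivalence of Euclidean spaces. -/
def appendEquiv (d1 d2 : ℕ) :
    (EuclideanSpace ℝ (Fin d1) × EuclideanSpace ℝ (Fin d2)) ≃L[ℝ]
      EuclideanSpace ℝ (Fin (d1 + d2)) :=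
  LinearEquiv.toContinuousLinearEquiv
    { toFun := fun p => (EuclideanSpace.equiv (Fin (d1 + d2)) ℝ).symm
        (Fin.append (EuclideanSpace.equiv (Fin d1) ℝ p.1) (EuclideanSpace.equiv (Fin d2) ℝ p.2))
      map_add' := fun p q => by
        ext i
        refine Fin.addCases (fun j => ?_) (fun j => ?_) i <;> simp
      map_smul' := fun c p => by
        ext i
        refine Fin.addCases (fun j => ?_) (fun j => ?_) i <;> simp
      invFun := fun x => ((EuclideanSpace.equiv (Fin d1) ℝ).symm fun j => x (Fin.castAdd d2 j),
        (EuclideanSpace.equiv (Fin d2) ℝ).symm fun j => x (Fin.natAdd d1 j))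
      left_inv := fun p => by ext j <;> simp
      right_inv := fun x => by
        ext i
        refine Fin.addCases (fun j => ?_) (fun j => ?_) i <;> simp }

set_option linter.unusedSectionVars false

theorem appendEquiv_rComb {d1 d2 : ℕ} (r1θ : 𝓩 → EuclideanSpace ℝ (Fin d1))
    (r2θ : 𝓤 → 𝓩 → EuclideanSpace ℝ (Fin d2)) (u : 𝓤) (z : 𝓩) :
    rComb r1θ r2θ u z = appendEquiv d1 d2 (r1θ z, r2θ u z) := rfl

/-- Taking inner products with linearly independent vectors `λ₁, …, λ_d` is a linear
equivalence of `ℝᵈ`. -/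
theorem exists_equiv_apply_eq_inner {d : ℕ} {lam : Fin d → EuclideanSpace ℝ (Fin d)}
    (hlam : LinearIndependent ℝ lam) :
    ∃ A : EuclideanSpace ℝ (Fin d) ≃L[ℝ] EuclideanSpace ℝ (Fin d),
      ∀ m, A m = (EuclideanSpace.equiv (Fin d) ℝ).symm fun i => ⟪lam i, m⟫ := by
  let A : EuclideanSpace ℝ (Fin d) →ₗ[ℝ] EuclideanSpace ℝ (Fin d) :=
    (EuclideanSpace.equiv (Fin d) ℝ).symm.toLinearMap ∘ₗ
      LinearMap.pi fun i => innerₛₗ ℝ (lam i)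
  have hA : Function.Injective A := by
    refine LinearMap.ker_eq_bot.1 (LinearMap.ker_eq_bot'.2 fun m hm => ?_)
    have hinner : ∀ i, ⟪lam i, m⟫ = 0 := fun i => congrArg (fun x => x i) hm
    have hspan : Submodule.span ℝ (range lam) = ⊤ :=
      hlam.span_eq_top_of_card_eq_finrank' (by simp)
    have hle : Submodule.span ℝ (range lam) ≤ (ℝ ∙ m)ᗮ := by
      rw [Submodule.span_le]
      rintro _ ⟨i, rfl⟩
      exact Submodule.mem_orthogonal_singleton_iff_inner_left.2 (hinner i)
    have hm' : m ∈ (ℝ ∙ m)ᗮ := hle (hspan ▸ Submodule.mem_top)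
    exact inner_self_eq_zero.1 (Submodule.mem_orthogonal_singleton_iff_inner_left.1 hm')
  exact ⟨(LinearEquiv.ofInjectiveEndo A hA).toContinuousLinearEquiv, fun m => rfl⟩

/-- On the support of the reduced model, its moment function is an invertible linear transform of
the original moment function. -/
theorem exists_equiv_redR_eq {d1 d2 : ℕ} (Γθ : Set (𝓤 × 𝓩)) (r1θ : 𝓩 → EuclideanSpace ℝ (Fin d1))
    (r2θ : 𝓤 → 𝓩 → EuclideanSpace ℝ (Fin d2)) (h : 0 < d2)
    {lam : Fin d2 → EuclideanSpace ℝ (Fin d2)} (hlam : LinearIndependent ℝ lam) :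
    ∃ L : EuclideanSpace ℝ (Fin (d1 + d2)) ≃L[ℝ] EuclideanSpace ℝ (Fin (d1 + d2)),
      ∀ p ∈ redGamma Γθ r2θ (lam ⟨0, h⟩),
        redR Γθ r1θ r2θ h lam p.1 p.2 = L (rComb r1θ r2θ p.1 p.2) := by
  obtain ⟨A, hA⟩ := exists_equiv_apply_eq_inner hlam
  refine ⟨((appendEquiv d1 d2).symm.trans
    ((ContinuousLinearEquiv.refl ℝ _).prodCongr A)).trans (appendEquiv d1 d2), fun p hp => ?_⟩
  have hL : ((appendEquiv d1 d2).symm.trans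
      ((ContinuousLinearEquiv.refl ℝ _).prodCongr A)).trans (appendEquiv d1 d2)
        (rComb r1θ r2θ p.1 p.2) = appendEquiv d1 d2 (r1θ p.2, A (r2θ p.1 p.2)) := by
    simp [appendEquiv_rComb]
  rw [hL, hA]
  have hvec : (fun i : Fin d2 =>
      if (i : ℕ) = 0 then (suppFun2 Γθ r2θ (lam ⟨0, h⟩) p.2).toReal else ⟪lam i, r2θ p.1 p.2⟫) =
      fun i => ⟪lam i, r2θ p.1 p.2⟫ := by
    funext i
    split_ifs with hi
    · rw [← hp.2, EReal.toReal_coe, show i = ⟨0, h⟩ from Fin.ext hi]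
    · rfl
  rw [redR, hvec]
  rfl

/-- The points `(u, z)` of `Γ(θ)` at which `λᵀ r₂(·,z;θ)` is not maximal over `Γ(z;θ)`. -/
def improvableSet {d2 : ℕ} (Γθ : Set (𝓤 × 𝓩)) (r2θ : 𝓤 → 𝓩 → EuclideanSpace ℝ (Fin d2))
    (l : EuclideanSpace ℝ (Fin d2)) : Set (𝓤 × 𝓩) :=
  {p ∈ Γθ | ∃ u ∈ sectionSet Γθ p.2, ⟪l, r2θ p.1 p.2⟫ < ⟪l, r2θ u p.2⟫}

theorem redGamma_eq_sdiff_improvableSet {d2 : ℕ} (Γθ : Set (𝓤 × 𝓩))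
    (r2θ : 𝓤 → 𝓩 → EuclideanSpace ℝ (Fin d2)) (l : EuclideanSpace ℝ (Fin d2)) :
    redGamma Γθ r2θ l = Γθ \ improvableSet Γθ r2θ l := by
  ext p
  simp only [redGamma, improvableSet, mem_sdiff, mem_ofPred_eq, not_and, not_exists, not_lt]
  refine and_congr_right fun hp => ⟨fun h _ u hu => ?_, fun h => le_antisymm ?_ ?_⟩
  · rw [← EReal.coe_le_coe_iff, h]
    exact le_sSup ⟨u, hu, rfl⟩
  · exact le_sSup ⟨p.1, hp, rfl⟩
  · refine sSup_le ?_
    rintro _ ⟨u, hu, rfl⟩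
    exact EReal.coe_le_coe_iff.2 (h hp u hu)

/-- If the set of improvable points is not negligible, the improvement can be carried out in a
measurable way on a set of positive measure. -/
theorem exists_measurable_improvement {d2 : ℕ} {Γθ : Set (𝓤 × 𝓩)} (hΓ : MeasurableSet Γθ)
    {r2θ : 𝓤 → 𝓩 → EuclideanSpace ℝ (Fin d2)} (hr : Measurable fun p : 𝓤 × 𝓩 => r2θ p.1 p.2)
    (l : EuclideanSpace ℝ (Fin d2)) (H : Measure (𝓤 × 𝓩)) [IsFiniteMeasure H]
    (h : H (improvableSet Γθ r2θ l) ≠ 0) :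
    ∃ (B : Set (𝓤 × 𝓩)) (s : 𝓤 × 𝓩 → 𝓤), MeasurableSet B ∧ H B ≠ 0 ∧ Measurable s ∧
      ∀ p ∈ B, p ∈ Γθ ∧ (s p, p.2) ∈ Γθ ∧ ⟪l, r2θ p.1 p.2⟫ < ⟪l, r2θ (s p) p.2⟫ := by
  let S : Set ((𝓤 × 𝓩) × 𝓤) := {q | q.1 ∈ Γθ ∧ (q.2, q.1.2) ∈ Γθ ∧
    ⟪l, r2θ q.1.1 q.1.2⟫ < ⟪l, r2θ q.2 q.1.2⟫}
  have hswap : Measurable fun q : (𝓤 × 𝓩) × 𝓤 => (q.2, q.1.2) := by fun_prop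
  have hlt : MeasurableSet {q : (𝓤 × 𝓩) × 𝓤 | ⟪l, r2θ q.1.1 q.1.2⟫ < ⟪l, r2θ q.2 q.1.2⟫} :=
    measurableSet_lt ((hr.comp measurable_fst).const_inner) ((hr.comp hswap).const_inner)
  have hS : MeasurableSet S := (measurable_fst hΓ).inter ((hswap hΓ).inter hlt)
  have hproj : Prod.fst '' S = improvableSet Γθ r2θ l := by
    ext p
    constructor
    · rintro ⟨q, ⟨h₁, h₂, h₃⟩, rfl⟩
      exact ⟨h₁, q.2, h₂, h₃⟩
    · rintro ⟨h₁, u, h₂, h₃⟩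
      exact ⟨(p, u), ⟨h₁, h₂, h₃⟩, rfl⟩
  exact hS.exists_measurable_selection H (hproj ▸ h)

/-- `H` is a probability measure carried by `Γ(θ)` with `𝓩`-marginal `F`. -/
structure IsCoupling (Γθ : Set (𝓤 × 𝓩)) (F : Measure 𝓩) (H : Measure (𝓤 × 𝓩)) : Prop where
  isProbabilityMeasure : IsProbabilityMeasure H
  measure_eq_one : H Γθ = 1
  map_snd : H.map Prod.snd = F

theorem isCoupling_redGamma_iff {d2 : ℕ} {Γθ : Set (𝓤 × 𝓩)} (hΓ : MeasurableSet Γθ)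
    {r2θ : 𝓤 → 𝓩 → EuclideanSpace ℝ (Fin d2)} (hr : Measurable fun p : 𝓤 × 𝓩 => r2θ p.1 p.2)
    (l : EuclideanSpace ℝ (Fin d2)) (F : Measure 𝓩) (H : Measure (𝓤 × 𝓩)) :
    IsCoupling (redGamma Γθ r2θ l) F H ↔
      IsCoupling Γθ F H ∧ H (improvableSet Γθ r2θ l) = 0 := by
  rw [redGamma_eq_sdiff_improvableSet]
  refine ⟨fun ⟨_, hone, hmap⟩ => ⟨⟨‹_›, ?_, hmap⟩, ?_⟩, fun ⟨⟨_, hone, hmap⟩, h0⟩ => ⟨‹_›, ?_, hmap⟩⟩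
  · exact le_antisymm prob_le_one (hone ▸ measure_mono sdiff_subset)
  · by_contra h
    obtain ⟨B, s, hB, hHB, -, hs⟩ := exists_measurable_improvement hΓ hr l H h
    have hsub : Γθ \ improvableSet Γθ r2θ l ⊆ Bᶜ := fun p hp hpB =>
      hp.2 ⟨hp.1, s p, (hs p hpB).2.1, (hs p hpB).2.2⟩
    have : H Bᶜ = 1 := le_antisymm prob_le_one (hone ▸ measure_mono hsub)
    exact hHB ((prob_compl_eq_one_iff hB).1 this)
  · rw [measure_sdiff_null h0, hone]

/-- Membership in the identified set of the reduced model, in terms of the original model. -/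
theorem memIdentified_redGamma_iff {d1 d2 : ℕ} {Γθ : Set (𝓤 × 𝓩)} (hΓ : MeasurableSet Γθ)
    (r1θ : 𝓩 → EuclideanSpace ℝ (Fin d1)) {r2θ : 𝓤 → 𝓩 → EuclideanSpace ℝ (Fin d2)}
    (hr : Measurable fun p : 𝓤 × 𝓩 => r2θ p.1 p.2) (h : 0 < d2)
    {lam : Fin d2 → EuclideanSpace ℝ (Fin d2)} (hlam : LinearIndependent ℝ lam) (F : Measure 𝓩) :
    MemIdentified (redGamma Γθ r2θ (lam ⟨0, h⟩)) (redR Γθ r1θ r2θ h lam) F ↔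
      ∃ H : Measure (𝓤 × 𝓩), IsCoupling Γθ F H ∧ H (improvableSet Γθ r2θ (lam ⟨0, h⟩)) = 0 ∧
        Integrable (fun p : 𝓤 × 𝓩 => rComb r1θ r2θ p.1 p.2) H ∧
        ∫ p : 𝓤 × 𝓩, rComb r1θ r2θ p.1 p.2 ∂H = 0 := by
  obtain ⟨L, hL⟩ := exists_equiv_redR_eq Γθ r1θ r2θ h hlam
  refine exists_congr fun H => ?_
  have hc := isCoupling_redGamma_iff hΓ hr (lam ⟨0, h⟩) F H
  have key : IsCoupling Γθ F H ∧ H (improvableSet Γθ r2θ (lam ⟨0, h⟩)) = 0 →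
      ((Integrable (fun p : 𝓤 × 𝓩 => redR Γθ r1θ r2θ h lam p.1 p.2) H ↔
        Integrable (fun p : 𝓤 × 𝓩 => rComb r1θ r2θ p.1 p.2) H) ∧
      (∫ p : 𝓤 × 𝓩, redR Γθ r1θ r2θ h lam p.1 p.2 ∂H = 0 ↔
        ∫ p : 𝓤 × 𝓩, rComb r1θ r2θ p.1 p.2 ∂H = 0)) := by
    rintro ⟨⟨_, hone, -⟩, h0⟩
    have hae : (fun p : 𝓤 × 𝓩 => redR Γθ r1θ r2θ h lam p.1 p.2) =ᵐ[H]
        fun p => L (rComb r1θ r2θ p.1 p.2) := by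
      filter_upwards [(mem_ae_iff_prob_eq_one hΓ).2 hone, measure_eq_zero_iff_ae_notMem.1 h0]
        with p hp hp'
      exact hL p (redGamma_eq_sdiff_improvableSet Γθ r2θ _ ▸ ⟨hp, hp'⟩)
    rw [integrable_congr hae, integral_congr_ae hae, L.integral_comp_comm, L.map_eq_zero_iff]
    exact ⟨L.integrable_comp_iff, Iff.rfl⟩
  constructor
  · rintro ⟨h₁, h₂, h₃, h₄, h₅⟩
    have := hc.1 ⟨h₁, h₂, h₃⟩
    exact ⟨this.1, this.2, (key this).1.1 h₄, (key this).2.1 h₅⟩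
  · rintro ⟨h₁, h₂, h₃, h₄⟩
    obtain ⟨h₅, h₆, h₇⟩ := hc.2 ⟨h₁, h₂⟩
    exact ⟨h₅, h₆, h₇, (key ⟨h₁, h₂⟩).1.2 h₃, (key ⟨h₁, h₂⟩).2.2 h₄⟩

/-- A coupling under which `λᵀ r₂` is not almost surely maximal can be replaced by one with the
same marginal and a larger mean of `λᵀ r₂`. -/
theorem IsCoupling.exists_integral_inner_lt {d2 : ℕ} {Γθ : Set (𝓤 × 𝓩)} (hΓ : MeasurableSet Γθ)
    {r2θ : 𝓤 → 𝓩 → EuclideanSpace ℝ (Fin d2)} (hr : Measurable fun p : 𝓤 × 𝓩 => r2θ p.1 p.2)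
    {l : EuclideanSpace ℝ (Fin d2)} {F : Measure 𝓩} {H : Measure (𝓤 × 𝓩)}
    (hH : IsCoupling Γθ F H) (hint : Integrable (fun p : 𝓤 × 𝓩 => r2θ p.1 p.2) H)
    (h : H (improvableSet Γθ r2θ l) ≠ 0) :
    ∃ H' : Measure (𝓤 × 𝓩), IsCoupling Γθ F H' ∧
      Integrable (fun p : 𝓤 × 𝓩 => r2θ p.1 p.2) H' ∧
      ⟪l, ∫ p : 𝓤 × 𝓩, r2θ p.1 p.2 ∂H⟫ < ⟪l, ∫ p : 𝓤 × 𝓩, r2θ p.1 p.2 ∂H'⟫ := by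
  classical
  obtain ⟨_, hone, hmap⟩ := hH
  obtain ⟨B, s, hB, hHB, hs, hBs⟩ := exists_measurable_improvement hΓ hr l H h
  have hmove : Measurable fun p : 𝓤 × 𝓩 => (s p, p.2) := hs.prodMk measurable_snd
  have hnorm : Measurable fun p : 𝓤 × 𝓩 => ‖r2θ (s p) p.2‖ := (hr.comp hmove).norm
  obtain ⟨M, hM⟩ : ∃ M : ℕ, H (B ∩ {p | ‖r2θ (s p) p.2‖ ≤ M}) ≠ 0 := by
    by_contra! hzero
    refine hHB (measure_mono_null (fun p hp => ?_) (measure_iUnion_null hzero))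
    obtain ⟨M, hM⟩ := exists_nat_ge ‖r2θ (s p) p.2‖
    exact mem_iUnion.2 ⟨M, hp, hM⟩
  set D := B ∩ {p | ‖r2θ (s p) p.2‖ ≤ M} with hDdef
  have hD : MeasurableSet D := hB.inter (measurableSet_le hnorm measurable_const)
  let T : 𝓤 × 𝓩 → 𝓤 × 𝓩 := D.piecewise (fun p => (s p, p.2)) id
  have hT : Measurable T := hmove.piecewise hD measurable_id
  have hTD : ∀ p ∈ D, T p = (s p, p.2) := fun p hp => piecewise_eq_of_mem _ _ _ hp
  have hTD' : ∀ p ∉ D, T p = p := fun p hp => piecewise_eq_of_notMem _ _ _ hp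
  have hTint : Integrable (fun p => r2θ (T p).1 (T p).2) H := by
    refine (hint.norm.add (integrable_const (M : ℝ))).mono' (hr.comp hT).aestronglyMeasurable
      (Filter.Eventually.of_forall fun p => ?_)
    simp only [Pi.add_apply]
    by_cases hp : p ∈ D
    · rw [hTD p hp]
      exact hp.2.trans (le_add_of_nonneg_left (norm_nonneg _))
    · rw [hTD' p hp]
      exact le_add_of_nonneg_right (Nat.cast_nonneg M)
  refine ⟨H.map T, ⟨Measure.isProbabilityMeasure_map hT.aemeasurable, ?_, ?_⟩, ?_, ?_⟩
  · rw [Measure.map_apply hT hΓ]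
    refine le_antisymm prob_le_one (hone ▸ measure_mono fun p hp => ?_)
    by_cases hpD : p ∈ D
    · rw [mem_preimage, hTD p hpD]
      exact (hBs p hpD.1).2.1
    · rwa [mem_preimage, hTD' p hpD]
  · rw [Measure.map_map measurable_snd hT, ← hmap]
    congr 1
    funext p
    by_cases hpD : p ∈ D
    · rw [Function.comp_apply, hTD p hpD]
    · rw [Function.comp_apply, hTD' p hpD]
  · exact (integrable_map_measure hr.aestronglyMeasurable hT.aemeasurable).2 hTint
  · rw [integral_map hT.aemeasurable hr.aestronglyMeasurable, ← sub_pos, ← inner_sub_right,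
      ← integral_sub' hTint hint, ← integral_inner (hTint.sub hint),
      integral_pos_iff_support_of_nonneg (fun p => ?_) ((hTint.sub hint).const_inner l)]
    · refine (pos_iff_ne_zero.2 hM).trans_le (measure_mono fun p hp => ?_)
      rw [Function.mem_support, Pi.sub_apply, hTD p hp, inner_sub_right]
      exact (sub_pos.2 (hBs p hp.1).2.2).ne'
    · simp only [Pi.zero_apply, Pi.sub_apply]
      by_cases hp : p ∈ D
      · rw [hTD p hp, inner_sub_right]
        exact (sub_pos.2 (hBs p hp.1).2.2).le
      · rw [hTD' p hp, sub_self, inner_zero_right]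

theorem integrable_and_integral_convexComb {X E : Type*} [MeasurableSpace X]
    [NormedAddCommGroup E] [NormedSpace ℝ E] {μ ν : Measure X} {f : X → E}
    (hμ : Integrable f μ) (hν : Integrable f ν) {a b : ℝ} (ha : 0 ≤ a) (hb : 0 ≤ b) :
    Integrable f (ENNReal.ofReal a • μ + ENNReal.ofReal b • ν) ∧
      ∫ x, f x ∂(ENNReal.ofReal a • μ + ENNReal.ofReal b • ν) =
        a • ∫ x, f x ∂μ + b • ∫ x, f x ∂ν := by
  have hμ' := hμ.smul_measure (c := ENNReal.ofReal a) ENNReal.ofReal_ne_top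
  have hν' := hν.smul_measure (c := ENNReal.ofReal b) ENNReal.ofReal_ne_top
  refine ⟨hμ'.add_measure hν', ?_⟩
  rw [integral_add_measure hμ' hν', integral_smul_measure, integral_smul_measure,
    ENNReal.toReal_ofReal ha, ENNReal.toReal_ofReal hb]

theorem IsCoupling.convexComb {Γθ : Set (𝓤 × 𝓩)} {F₁ F₂ : Measure 𝓩} {H₁ H₂ : Measure (𝓤 × 𝓩)}
    (h₁ : IsCoupling Γθ F₁ H₁) (h₂ : IsCoupling Γθ F₂ H₂) {a b : ℝ} (ha : 0 ≤ a) (hb : 0 ≤ b)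
    (hab : a + b = 1) :
    IsCoupling Γθ (ENNReal.ofReal a • F₁ + ENNReal.ofReal b • F₂)
      (ENNReal.ofReal a • H₁ + ENNReal.ofReal b • H₂) := by
  obtain ⟨_, hone₁, rfl⟩ := h₁
  obtain ⟨_, hone₂, rfl⟩ := h₂
  have hsum : ENNReal.ofReal a + ENNReal.ofReal b = 1 := by
    rw [← ENNReal.ofReal_add ha hb, hab, ENNReal.ofReal_one]
  exact ⟨⟨by simp [hsum]⟩, by simp [hone₁, hone₂, hsum],
    by simp [Measure.map_add _ _ measurable_snd, Measure.map_smul]⟩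

/-- The mean moments that are compatible with some distribution of the family `𝓕`. -/
def attainableMoments {d : ℕ} (𝓕 : Set (Measure 𝓩)) (Γθ : Set (𝓤 × 𝓩))
    (rθ : 𝓤 → 𝓩 → EuclideanSpace ℝ (Fin d)) : Set (EuclideanSpace ℝ (Fin d)) :=
  {m | ∃ F ∈ 𝓕, ∃ H : Measure (𝓤 × 𝓩), IsCoupling Γθ F H ∧
    Integrable (fun p : 𝓤 × 𝓩 => rθ p.1 p.2) H ∧ ∫ p : 𝓤 × 𝓩, rθ p.1 p.2 ∂H = m}

theorem ConvexFamily.convex_attainableMoments {d : ℕ} {𝓕 : Set (Measure 𝓩)}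
    (h𝓕 : ConvexFamily 𝓕) (Γθ : Set (𝓤 × 𝓩)) (rθ : 𝓤 → 𝓩 → EuclideanSpace ℝ (Fin d)) :
    Convex ℝ (attainableMoments 𝓕 Γθ rθ) := by
  rintro _ ⟨F₁, hF₁, H₁, hH₁, hr₁, rfl⟩ _ ⟨F₂, hF₂, H₂, hH₂, hr₂, rfl⟩ a b ha hb hab
  obtain ⟨hint, hval⟩ := integrable_and_integral_convexComb hr₁ hr₂ ha hb
  refine ⟨_, ?_, _, hH₁.convexComb hH₂ ha hb hab, hint, hval⟩
  rw [← sub_eq_of_eq_add' hab.symm]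
  exact h𝓕 F₁ hF₁ F₂ hF₂ a ha (by linarith)

theorem IsCoupling.integrable_rComb_iff {d1 d2 : ℕ} {Γθ : Set (𝓤 × 𝓩)} {F : Measure 𝓩}
    {H : Measure (𝓤 × 𝓩)} (hH : IsCoupling Γθ F H) {r1θ : 𝓩 → EuclideanSpace ℝ (Fin d1)}
    (hr1 : Integrable r1θ F) {r2θ : 𝓤 → 𝓩 → EuclideanSpace ℝ (Fin d2)} :
    Integrable (fun p : 𝓤 × 𝓩 => rComb r1θ r2θ p.1 p.2) H ↔
      Integrable (fun p : 𝓤 × 𝓩 => r2θ p.1 p.2) H := by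
  obtain ⟨_, -, rfl⟩ := hH
  simp only [appendEquiv_rComb]
  rw [(appendEquiv d1 d2).integrable_comp_iff]
  exact ⟨fun h => h.snd, fun h => (hr1.comp_measurable measurable_snd).prodMk h⟩

theorem IsCoupling.integral_rComb {d1 d2 : ℕ} {Γθ : Set (𝓤 × 𝓩)} {F : Measure 𝓩}
    {H : Measure (𝓤 × 𝓩)} (hH : IsCoupling Γθ F H) {r1θ : 𝓩 → EuclideanSpace ℝ (Fin d1)}
    (hr1 : Integrable r1θ F) {r2θ : 𝓤 → 𝓩 → EuclideanSpace ℝ (Fin d2)}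
    (hr2 : Integrable (fun p : 𝓤 × 𝓩 => r2θ p.1 p.2) H) :
    ∫ p : 𝓤 × 𝓩, rComb r1θ r2θ p.1 p.2 ∂H =
      appendEquiv d1 d2 (∫ z, r1θ z ∂F, ∫ p : 𝓤 × 𝓩, r2θ p.1 p.2 ∂H) := by
  obtain ⟨_, -, rfl⟩ := hH
  have hr1' : Integrable (fun p : 𝓤 × 𝓩 => r1θ p.2) H := hr1.comp_measurable measurable_snd
  simp only [appendEquiv_rComb]
  rw [(appendEquiv d1 d2).integral_comp_comm, integral_pair hr1' hr2,
    integral_map measurable_snd.aemeasurable hr1.aestronglyMeasurable]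

/-- In an irreducible model, every small value of the mean of `r₂` is attainable together with a
zero mean of `r₁`. -/
theorem zero_mem_interior_attainableMoments {d1 d2 : ℕ} {𝓕 : Set (Measure 𝓩)}
    (hconv : ConvexFamily 𝓕) {Γ : Θ → Set (𝓤 × 𝓩)} {r1 : Θ → 𝓩 → EuclideanSpace ℝ (Fin d1)}
    {r2 : Θ → 𝓤 → 𝓩 → EuclideanSpace ℝ (Fin d2)} (hirred : ¬ Reducible 𝓕 Γ r1 r2)
    (hd2 : 0 < d2) (θ : Θ) (hΓ : MeasurableSet (Γ θ))
    (hr2 : Measurable fun p : 𝓤 × 𝓩 => r2 θ p.1 p.2) (hr1 : ∀ F ∈ 𝓕, Integrable (r1 θ) F) :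
    (0 : EuclideanSpace ℝ (Fin d2)) ∈ interior
      {m | appendEquiv d1 d2 (0, m) ∈ attainableMoments 𝓕 (Γ θ) (rComb (r1 θ) (r2 θ))} := by
  have : Nonempty (Fin d2) := ⟨⟨0, hd2⟩⟩
  by_contra h
  have hC : Convex ℝ
      {m | appendEquiv d1 d2 (0, m) ∈ attainableMoments 𝓕 (Γ θ) (rComb (r1 θ) (r2 θ))} :=
    (hconv.convex_attainableMoments (Γ θ) (rComb (r1 θ) (r2 θ))).linear_preimage
      ((appendEquiv d1 d2).toLinearMap ∘ₗ LinearMap.inr ℝ _ _)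
  obtain ⟨l, hl0, hl⟩ := hC.exists_inner_nonpos_of_zero_notMem_interior h
  obtain ⟨lam, hlam, rfl⟩ := exists_linearIndependent_apply_zero_eq hd2 hl0
  refine hirred ⟨θ, hd2, lam, hlam, fun F hF => ?_⟩
  rw [memIdentified_redGamma_iff hΓ (r1 θ) hr2 hd2 hlam F]
  constructor
  · rintro ⟨H, hprob, hone, hmap, hint, hzero⟩
    have hH : IsCoupling (Γ θ) F H := ⟨hprob, hone, hmap⟩
    refine ⟨H, hH, ?_, hint, hzero⟩
    by_contra hpos
    have hint2 := (hH.integrable_rComb_iff (hr1 F hF)).1 hint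
    obtain ⟨H', hH', hint', hlt⟩ := hH.exists_integral_inner_lt hΓ hr2 hint2 hpos
    rw [hH.integral_rComb (hr1 F hF) hint2, (appendEquiv d1 d2).map_eq_zero_iff,
      Prod.mk_eq_zero] at hzero
    rw [hzero.2, inner_zero_right] at hlt
    refine hlt.not_ge (hl _ ⟨F, hF, H', hH', (hH'.integrable_rComb_iff (hr1 F hF)).2 hint', ?_⟩)
    rw [hH'.integral_rComb (hr1 F hF) hint', hzero.1]
  · rintro ⟨H, hH, -, hint, hzero⟩
    exact ⟨H, hH.isProbabilityMeasure, hH.measure_eq_one, hH.map_snd, hint, hzero⟩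

/-- The exact moments of a distribution in the moment closure: `r₁` has mean zero, and `r₂` has
arbitrarily small means. -/
theorem MemMomentClosure.integral_eq_zero_and_exists {d1 d2 : ℕ} {Γθ : Set (𝓤 × 𝓩)}
    {F : Measure 𝓩} {r1θ : 𝓩 → EuclideanSpace ℝ (Fin d1)}
    {r2θ : 𝓤 → 𝓩 → EuclideanSpace ℝ (Fin d2)} (h : MemMomentClosure Γθ (rComb r1θ r2θ) F)
    (hr1 : Integrable r1θ F) :
    ∫ z, r1θ z ∂F = 0 ∧ ∀ ε : ℝ, 0 < ε → ∃ H : Measure (𝓤 × 𝓩), IsCoupling Γθ F H ∧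
      Integrable (fun p : 𝓤 × 𝓩 => r2θ p.1 p.2) H ∧ ‖∫ p : 𝓤 × 𝓩, r2θ p.1 p.2 ∂H‖ ≤ ε := by
  let e := (appendEquiv d1 d2).symm.toContinuousLinearMap
  have key : ∀ ε : ℝ, 0 < ε → ∃ H : Measure (𝓤 × 𝓩), IsCoupling Γθ F H ∧
      Integrable (fun p : 𝓤 × 𝓩 => r2θ p.1 p.2) H ∧
      ‖(∫ z, r1θ z ∂F, ∫ p : 𝓤 × 𝓩, r2θ p.1 p.2 ∂H)‖ ≤ ε := by
    intro ε hε
    have hpos : 0 < ‖e‖ + 1 := by positivity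
    obtain ⟨H, hprob, hone, hmap, hint, hle⟩ := h (ε / (‖e‖ + 1)) (by positivity)
    have hH : IsCoupling Γθ F H := ⟨hprob, hone, hmap⟩
    have hint2 := (hH.integrable_rComb_iff hr1).1 hint
    refine ⟨H, hH, hint2, ?_⟩
    have he : e (∫ p : 𝓤 × 𝓩, rComb r1θ r2θ p.1 p.2 ∂H) =
        (∫ z, r1θ z ∂F, ∫ p : 𝓤 × 𝓩, r2θ p.1 p.2 ∂H) := by
      rw [hH.integral_rComb hr1 hint2]
      exact (appendEquiv d1 d2).symm_apply_apply _
    rw [← he]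
    calc ‖e (∫ p : 𝓤 × 𝓩, rComb r1θ r2θ p.1 p.2 ∂H)‖
        ≤ ‖e‖ * ‖∫ p : 𝓤 × 𝓩, rComb r1θ r2θ p.1 p.2 ∂H‖ := e.le_opNorm _
      _ ≤ (‖e‖ + 1) * (ε / (‖e‖ + 1)) := by gcongr; linarith
      _ = ε := by field_simp
  constructor
  · refine norm_le_zero_iff.1 (le_of_forall_pos_le_add fun ε hε => ?_)
    obtain ⟨H, -, -, hH⟩ := key ε hε
    simpa using (norm_fst_le _).trans hH
  · intro ε hε
    obtain ⟨H, hH, hint, hle⟩ := key ε hε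
    exact ⟨H, hH, hint, (norm_snd_le _).trans hle⟩

/-- Rejection probabilities are nearly preserved when a distribution is slightly contaminated. -/
theorem pow_mul_integral_pi_le {X : Type*} [MeasurableSpace X] {n : ℕ} {φ : (Fin n → X) → ℝ}
    (hφ : Measurable φ) (hφ01 : ∀ x, φ x ∈ Icc (0 : ℝ) 1) {F G : Measure X}
    [IsProbabilityMeasure F] [IsProbabilityMeasure G] {c : ℝ} (hc : 0 ≤ c)
    (h : ENNReal.ofReal c • F ≤ G) :
    c ^ n * ∫ x, φ x ∂(Measure.pi fun _ : Fin n => F) ≤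
      ∫ x, φ x ∂(Measure.pi fun _ : Fin n => G) := by
  have hle := smul_pi_le_pi (ι := Fin n) h
  have hint : Integrable φ (Measure.pi fun _ : Fin n => G) :=
    Integrable.of_mem_Icc 0 1 hφ.aemeasurable (Filter.Eventually.of_forall hφ01)
  have := integral_mono_measure hle (Filter.Eventually.of_forall fun x => (hφ01 x).1) hint
  rwa [integral_smul_measure, Fintype.card_fin, ENNReal.toReal_pow, ENNReal.toReal_ofReal hc,
    smul_eq_mul] at this

/-- In an irreducible model, every distribution in the moment closure can be contaminated by an
arbitrarily small amount so as to satisfy the moment condition exactly. -/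
theorem MemMomentClosure.exists_memIdentified {d1 d2 : ℕ} {𝓕 : Set (Measure 𝓩)}
    (hconv : ConvexFamily 𝓕) {Γ : Θ → Set (𝓤 × 𝓩)} {r1 : Θ → 𝓩 → EuclideanSpace ℝ (Fin d1)}
    {r2 : Θ → 𝓤 → 𝓩 → EuclideanSpace ℝ (Fin d2)} (hirred : ¬ Reducible 𝓕 Γ r1 r2)
    {θ : Θ} (hΓ : MeasurableSet (Γ θ)) (hr2 : Measurable fun p : 𝓤 × 𝓩 => r2 θ p.1 p.2)
    (hr1 : ∀ F ∈ 𝓕, Integrable (r1 θ) F) {F : Measure 𝓩} (hF : F ∈ 𝓕)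
    (h : MemMomentClosure (Γ θ) (rComb (r1 θ) (r2 θ)) F) {c : ℝ} (hc0 : 0 < c) (hc1 : c < 1) :
    ∃ G ∈ 𝓕, MemIdentified (Γ θ) (rComb (r1 θ) (r2 θ)) G ∧ ENNReal.ofReal c • F ≤ G := by
  obtain ⟨hmean, happrox⟩ := h.integral_eq_zero_and_exists (hr1 F hF)
  obtain rfl | hd2 := Nat.eq_zero_or_pos d2
  · obtain ⟨H, hH, hint, -⟩ := happrox 1 one_pos
    refine ⟨F, hF, ⟨H, hH.isProbabilityMeasure, hH.measure_eq_one, hH.map_snd,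
      (hH.integrable_rComb_iff (hr1 F hF)).2 hint, ?_⟩, ?_⟩
    · rw [hH.integral_rComb (hr1 F hF) hint, hmean, (appendEquiv d1 0).map_eq_zero_iff]
      exact Prod.ext rfl (Subsingleton.elim _ _)
    · refine Measure.le_iff.2 fun s _ => ?_
      rw [Measure.smul_apply, smul_eq_mul]
      exact mul_le_of_le_one_left' (ENNReal.ofReal_le_one.2 hc1.le)
  have hint0 := zero_mem_interior_attainableMoments hconv hirred hd2 θ hΓ hr2 hr1
  obtain ⟨ρ, hρ, hball⟩ := Metric.mem_nhds_iff.1 (mem_interior_iff_mem_nhds.1 hint0)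
  have hc1' : 0 < 1 - c := sub_pos.2 hc1
  obtain ⟨H, hH, hint, hle⟩ := happrox ((1 - c) / c * (ρ / 2)) (by positivity)
  set m := ∫ p : 𝓤 × 𝓩, r2 θ p.1 p.2 ∂H
  have hmem : -(c / (1 - c)) • m ∈ Metric.ball (0 : EuclideanSpace ℝ (Fin d2)) ρ := by
    rw [mem_ball_zero_iff, norm_smul, norm_neg, Real.norm_of_nonneg (by positivity)]
    calc c / (1 - c) * ‖m‖ ≤ c / (1 - c) * ((1 - c) / c * (ρ / 2)) := by gcongr
      _ = ρ / 2 := by field_simp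
      _ < ρ := half_lt_self hρ
  obtain ⟨F', hF', H', hH', hint', hval⟩ := hball hmem
  have hcomb := hH.convexComb hH' hc0.le hc1'.le (by ring)
  have hintH := (hH.integrable_rComb_iff (hr1 F hF)).2 hint
  obtain ⟨hintG, hvalG⟩ := integrable_and_integral_convexComb hintH hint' hc0.le hc1'.le
  refine ⟨_, hconv F hF F' hF' c hc0.le hc1.le, ⟨_, hcomb.isProbabilityMeasure,
    hcomb.measure_eq_one, hcomb.map_snd, hintG, ?_⟩, Measure.le_add_right le_rfl⟩
  rw [hvalG, hval, hH.integral_rComb (hr1 F hF) hint, hmean, ← map_smul, ← map_smul, ← map_add,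
    (appendEquiv d1 d2).map_eq_zero_iff]
  refine Prod.ext (by simp) ?_
  simp only [Prod.snd_add, Prod.smul_snd, Prod.snd_zero]
  rw [smul_smul, mul_neg, mul_div_cancel₀ _ hc1'.ne', neg_smul, add_neg_cancel]

/-- **Theorem 3 (irreducibility implies finite-sample indistinguishability).**
Suppose Assumption 1 holds, `𝓕` is convex, `r₁(·;θ)` is `F`-integrable for every `F ∈ 𝓕` and
`θ ∈ Θ`, and the model `(Γ, r)` is irreducible.  Then for every `θ ∈ Θ`, the hypothesis
`θ ∈ Θ_I(F)` is impossible to distinguish from the hypothesis `θ ∈ Θ̄_I(F)` in finite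
samples. -/
theorem irreducible_indistinguishable {d1 d2 : ℕ}
    (𝓕 : Set (Measure 𝓩)) (hprob : ∀ F ∈ 𝓕, IsProbabilityMeasure F)
    (hconv : ConvexFamily 𝓕)
    (Γ : Θ → Set (𝓤 × 𝓩)) (r1 : Θ → 𝓩 → EuclideanSpace ℝ (Fin d1))
    (r2 : Θ → 𝓤 → 𝓩 → EuclideanSpace ℝ (Fin d2))
    (h1 : Assumption1 𝓕 Γ (fun θ => rComb (r1 θ) (r2 θ)))
    (hr1int : ∀ F ∈ 𝓕, ∀ θ : Θ, Integrable (r1 θ) F)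
    (hirred : ¬ Reducible 𝓕 Γ r1 r2) :
    ∀ θ : Θ, Indistinguishable 𝓕 (Γ θ) (rComb (r1 θ) (r2 θ)) := by
  intro θ n φ hφ hφ01
  have hbdd : ∀ s : Set (Measure 𝓩), s ⊆ 𝓕 → BddAbove
      ((fun F : Measure 𝓩 => ∫ x, φ x ∂(Measure.pi fun _ : Fin n => F)) '' s) := by
    refine fun s hs => ⟨1, ?_⟩
    rintro _ ⟨F, hF, rfl⟩
    have := hprob F (hs hF)
    calc ∫ x, φ x ∂(Measure.pi fun _ : Fin n => F)
        ≤ ∫ _x, (1 : ℝ) ∂(Measure.pi fun _ : Fin n => F) :=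
          integral_mono_of_nonneg (Filter.Eventually.of_forall fun x => (hφ01 x).1)
            (integrable_const _) (Filter.Eventually.of_forall fun x => (hφ01 x).2)
      _ = 1 := by simp
  have hsub : {F ∈ 𝓕 | MemIdentified (Γ θ) (rComb (r1 θ) (r2 θ)) F} ⊆
      {F ∈ 𝓕 | MemMomentClosure (Γ θ) (rComb (r1 θ) (r2 θ)) F} := by
    rintro F ⟨hF, H, hp, hone, hmap, hint, hzero⟩
    exact ⟨hF, fun ε hε => ⟨H, hp, hone, hmap, hint, by rw [hzero, norm_zero]; exact hε.le⟩⟩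
  have hpert : ∀ F ∈ 𝓕, MemMomentClosure (Γ θ) (rComb (r1 θ) (r2 θ)) F → ∀ c : ℝ, 0 < c → c < 1 →
      ∃ G ∈ 𝓕, MemIdentified (Γ θ) (rComb (r1 θ) (r2 θ)) G ∧ ENNReal.ofReal c • F ≤ G := by
    intro F hF hmem c hc0 hc1
    have hA := h1 θ F hF
    have hr2 : Measurable fun p : 𝓤 × 𝓩 => r2 θ p.1 p.2 := by
      have := (measurable_snd.comp (appendEquiv d1 d2).symm.continuous.measurable).comp
        hA.measurable_r
      simpa [Function.comp_def, appendEquiv_rComb] using this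
    exact hmem.exists_memIdentified hconv hirred hA.borel_Gamma hr2
      (fun F hF => hr1int F hF θ) hF hc0 hc1
  obtain hempty | ⟨F₀, hF₀, hmem₀⟩ :=
    {F ∈ 𝓕 | MemMomentClosure (Γ θ) (rComb (r1 θ) (r2 θ)) F}.eq_empty_or_nonempty
  · rw [hempty] at hsub ⊢
    rw [subset_empty_iff.1 hsub]
  obtain ⟨G₀, hG₀, hmemG₀, -⟩ := hpert F₀ hF₀ hmem₀ (1 / 2) (by norm_num) (by norm_num)
  refine le_antisymm (csSup_le_csSup (hbdd _ (sep_subset _ _))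
    (Set.Nonempty.image _ ⟨G₀, hG₀, hmemG₀⟩) (image_mono hsub))
    (csSup_le (Set.Nonempty.image _ ⟨F₀, hF₀, hmem₀⟩) ?_)
  rintro _ ⟨F, ⟨hF, hmem⟩, rfl⟩
  have hlim : Filter.Tendsto
      (fun c : ℝ => c ^ n * ∫ x, φ x ∂(Measure.pi fun _ : Fin n => F)) (nhdsWithin 1 (Iio 1))
      (nhds (∫ x, φ x ∂(Measure.pi fun _ : Fin n => F))) := by
    have : Continuous fun c : ℝ => c ^ n * ∫ x, φ x ∂(Measure.pi fun _ : Fin n => F) := by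
      fun_prop
    simpa using (this.tendsto 1).mono_left nhdsWithin_le_nhds
  refine le_of_tendsto hlim ?_
  filter_upwards [Ioo_mem_nhdsLT (zero_lt_one (α := ℝ))] with c hc
  obtain ⟨G, hG, hmemG, hle⟩ := hpert F hF hmem c hc.1 hc.2
  have := hprob F hF
  have := hprob G hG
  exact (pow_mul_integral_pi_le hφ hφ01 hc.1.le hle).trans
    (le_csSup (hbdd _ (sep_subset _ _)) ⟨G, ⟨hG, hmemG⟩, rfl⟩)

end
end
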